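/- arXiv:2211.16709 — 2 statements merged into one kernel-verified Lean document; each statement's English description precedes it below -/
import Mathlib

section
/- Let 1 ≤ m ≤ n be integers. For the fermionic Gaussian ensemble with arbitrary particle number, the average of the von Neumann entropy equals E[S] = (m+n−1/2)·ψ₀(2m+2n) + (1/4 − m)·ψ₀(m+n) + (1/2 − n)·ψ₀(2n) − (1/4)·ψ₀(n) − m. -/
open MeasureTheory Real Finset

/-- The entropy integrand `v(x) = (1-x)/2 · ln((1-x)/2) + (1+x)/2 · ln((1+x)/2)`. -/
noncomputable def vEnt (x : ℝ) : ℝ :=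
  (1 - x) / 2 * Real.log ((1 - x) / 2) + (1 + x) / 2 * Real.log ((1 + x) / 2)

/-- Digamma function at a positive integer: `ψ₀(k) = -γ + Σ_{j=1}^{k-1} 1/j`. -/
noncomputable def psi0 (k : ℕ) : ℝ :=
  -Real.eulerMascheroniConstant + ∑ j ∈ Finset.range (k - 1), 1 / (j + 1 : ℝ)

/-- The unnormalized fermionic-Gaussian eigenvalue density with arbitrary particle number. -/
noncomputable def densityA (m n : ℕ) (x : Fin m → ℝ) : ℝ :=
  if ∀ i, x i ∈ Set.Icc (0 : ℝ) 1 then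
    (∏ p ∈ Finset.univ.filter (fun p : Fin m × Fin m => p.1 < p.2),
      ((x p.1) ^ 2 - (x p.2) ^ 2) ^ 2) * ∏ i, (1 - (x i) ^ 2) ^ (n - m)
  else 0

/-- The von Neumann entropy `S(x) = -Σ_i v(x_i)`. -/
noncomputable def entS {m : ℕ} (x : Fin m → ℝ) : ℝ := -∑ i, vEnt (x i)

/-- Ensemble average of `g` with respect to the density `f`. -/
noncomputable def ensembleAvg {m : ℕ} (f : (Fin m → ℝ) → ℝ) (g : (Fin m → ℝ) → ℝ) : ℝ :=
  (∫ x, g x * f x) / (∫ x, f x)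

open Polynomial in
/-- The first-order operator with `((1-x²)^(a+1) r)' = (1-x²)^a · L r`. -/
noncomputable def Lop (a : ℕ) (r : ℝ[X]) : ℝ[X] :=
  (1 - X ^ 2) * derivative r - (2 * ((a : ℝ) + 1)) • (X * r)

open Polynomial in
/-- Monic Gegenbauer polynomials. -/
noncomputable def gp : ℕ → ℕ → ℝ[X]
  | 0, _ => 1
  | j + 1, a => (-1 / ((j : ℝ) + 2 * a + 2)) • Lop a (gp j (a + 1))

lemma logII : IntervalIntegrable (fun x : ℝ => Real.log ((1 + x) / 2)) volume (-1) 1 := by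
  have h : IntervalIntegrable Real.log volume 0 1 := intervalIntegral.intervalIntegrable_log'
  have h2 := (h.comp_mul_left (c := 1/2)).comp_add_left 1
  norm_num at h2
  refine h2.congr ?_
  intro x _
  simp only
  congr 1; ring

open Polynomial in
lemma BII (a : ℕ) (f : ℝ[X]) (u v : ℝ) :
    IntervalIntegrable (fun x : ℝ => f.eval x * (1 - x ^ 2) ^ a) volume u v := by
  apply Continuous.intervalIntegrable
  fun_prop

open Polynomial in
lemma TII (a : ℕ) (f : ℝ[X]) : IntervalIntegrable
    (fun x : ℝ => f.eval x * (1 - x ^ 2) ^ a * Real.log ((1 + x) / 2)) volume (-1) 1 := by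
  apply logII.continuousOn_mul
  apply Continuous.continuousOn
  fun_prop

open Polynomial in
/-- Integration against the weight. -/
noncomputable def Bf (a : ℕ) : ℝ[X] →ₗ[ℝ] ℝ where
  toFun f := ∫ x in (-1 : ℝ)..1, f.eval x * (1 - x ^ 2) ^ a
  map_add' f g := by
    rw [← intervalIntegral.integral_add (BII a f _ _) (BII a g _ _)]
    congr 1; ext x; simp; ring
  map_smul' c f := by
    simp only [RingHom.id_apply, smul_eq_mul]
    rw [← intervalIntegral.integral_const_mul]
    congr 1; ext x; simp; ring

open Polynomial in
/-- Integration against the weight times the logarithm. -/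
noncomputable def Tf (a : ℕ) : ℝ[X] →ₗ[ℝ] ℝ where
  toFun f := ∫ x in (-1 : ℝ)..1, f.eval x * (1 - x ^ 2) ^ a * Real.log ((1 + x) / 2)
  map_add' f g := by
    rw [← intervalIntegral.integral_add (TII a f) (TII a g)]
    congr 1; ext x; simp; ring
  map_smul' c f := by
    simp only [RingHom.id_apply, smul_eq_mul]
    rw [← intervalIntegral.integral_const_mul]
    congr 1; ext x; simp; ring

open Polynomial in
lemma Bf_apply (a : ℕ) (f : ℝ[X]) :
  Bf a f = ∫ x in (-1 : ℝ)..1, f.eval x * (1 - x ^ 2) ^ a := rfl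

open Polynomial in
lemma Tf_apply (a : ℕ) (f : ℝ[X]) :
  Tf a f = ∫ x in (-1 : ℝ)..1, f.eval x * (1 - x ^ 2) ^ a * Real.log ((1 + x) / 2) := rfl

open Polynomial in
lemma Bf_succ (a : ℕ) (f : ℝ[X]) : Bf (a + 1) f = Bf a ((1 - X ^ 2) * f) := by
  rw [Bf_apply, Bf_apply]; congr 1; ext x; simp; ring

open Polynomial in
lemma Tf_succ (a : ℕ) (f : ℝ[X]) : Tf (a + 1) f = Tf a ((1 - X ^ 2) * f) := by
  rw [Tf_apply, Tf_apply]; congr 1; ext x; simp only [eval_mul, eval_sub, eval_one, eval_pow, eval_X]; ring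

open Polynomial in
lemma hasDeriv_wf (a : ℕ) (f : ℝ[X]) (x : ℝ) :
    HasDerivAt (fun x : ℝ => f.eval x * (1 - x ^ 2) ^ (a + 1))
      ((Lop a f).eval x * (1 - x ^ 2) ^ a) x := by
  have h1 := f.hasDerivAt x
  have h2 : HasDerivAt (fun x : ℝ => 1 - x ^ 2) (-(2 * x)) x := by
    simpa using ((hasDerivAt_id x).pow 2).const_sub 1
  refine (h1.fun_mul (h2.fun_pow (a + 1))).congr_deriv ?_
  simp [Lop]
  ring

open Polynomial in
lemma Bf_Lop (a : ℕ) (f : ℝ[X]) : Bf a (Lop a f) = 0 := by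
  rw [Bf_apply, intervalIntegral.integral_eq_sub_of_hasDerivAt
    (fun x _ => hasDeriv_wf a f x) (BII _ _ _ _)]
  simp

open Polynomial in
lemma Tf_Lop (a : ℕ) (f : ℝ[X]) : Tf a (Lop a f) = - Bf a ((1 - X) * f) := by
  have hI : IntervalIntegrable (fun x : ℝ => (Lop a f).eval x * (1 - x ^ 2) ^ a *
      Real.log ((1 + x) / 2) + ((1 - X) * f).eval x * (1 - x ^ 2) ^ a) volume (-1) 1 :=
    (TII a _).add (BII a _ _ _)
  have key := intervalIntegral.integral_eq_sub_of_hasDerivAt_of_le (by norm_num)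
    (f := fun x : ℝ => f.eval x * (1 - x ^ 2) ^ (a + 1) * Real.log ((1 + x) / 2)) ?_ ?_ hI
  · rw [intervalIntegral.integral_add (TII a _) (BII a _ _ _), ← Tf_apply, ← Bf_apply] at key
    simp at key
    linarith
  · have : (fun x : ℝ => f.eval x * (1 - x ^ 2) ^ (a + 1) * Real.log ((1 + x) / 2)) =
        fun x : ℝ => f.eval x * (1 - x ^ 2) ^ a * (1 - x) * 2 *
          (((1 + x) / 2) * Real.log ((1 + x) / 2)) := by
      ext x; ring
    rw [this]
    apply Continuous.continuousOn
    have := Real.continuous_mul_log.comp (f := fun x : ℝ => (1 + x) / 2) (by fun_prop)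
    have h2 : Continuous (fun x : ℝ => ((1 + x) / 2) * Real.log ((1 + x) / 2)) := this
    fun_prop
  · intro x hx
    have hpos : (1 + x) / 2 ≠ 0 := by have := hx.1; intro h; linarith
    have h1 := hasDeriv_wf a f x
    have h2 : HasDerivAt (fun x : ℝ => (1 + x) / 2) (1 / 2) x :=
      ((hasDerivAt_id x).const_add 1).div_const 2
    refine (h1.fun_mul (h2.log hpos)).congr_deriv ?_
    have hx' : 1 + x ≠ 0 := by intro h; apply hpos; rw [h]; simp
    simp
    field_simp
    ring

open Polynomial in
lemma Lop_mul (a : ℕ) (r q : ℝ[X]) :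
    Lop a r * q = Lop a (r * q) - (1 - X ^ 2) * (r * derivative q) := by
  simp [Lop, smul_eq_C_mul]; ring

open Polynomial in
lemma Bf_Lop_mul (a : ℕ) (r q : ℝ[X]) :
    Bf a (Lop a r * q) = - Bf (a + 1) (r * derivative q) := by
  rw [Lop_mul, map_sub, Bf_Lop, Bf_succ]; ring

open Polynomial in
lemma Tf_Lop_mul (a : ℕ) (r q : ℝ[X]) :
    Tf a (Lop a r * q) = - Bf a ((1 - X) * (r * q)) - Tf (a + 1) (r * derivative q) := by
  rw [Lop_mul, map_sub, Tf_Lop, Tf_succ]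

open Polynomial in
lemma Bf_gp (j a : ℕ) (q : ℝ[X]) :
    ((j : ℝ) + 2 * a + 2) * Bf a (gp (j + 1) a * q) = Bf (a + 1) (gp j (a + 1) * derivative q) := by
  have : (j : ℝ) + 2 * a + 2 ≠ 0 := by positivity
  rw [gp, smul_mul_assoc, map_smul, Bf_Lop_mul, smul_eq_mul]; field_simp

open Polynomial in
lemma Tf_gp (j a : ℕ) (q : ℝ[X]) :
    ((j : ℝ) + 2 * a + 2) * Tf a (gp (j + 1) a * q) =
      Bf a ((1 - X) * (gp j (a + 1) * q)) + Tf (a + 1) (gp j (a + 1) * derivative q) := by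
  have : (j : ℝ) + 2 * a + 2 ≠ 0 := by positivity
  rw [gp, smul_mul_assoc, map_smul, Tf_Lop_mul, smul_eq_mul]; field_simp; ring

open Polynomial in
lemma derivative_Lop (a : ℕ) (r : ℝ[X]) :
    derivative (Lop a r) = Lop (a + 1) (derivative r) - (2 * ((a : ℝ) + 1)) • r := by
  have h2 : (C 2 : ℝ[X]) = 2 := rfl
  simp [Lop, smul_eq_C_mul, derivative_mul, h2]; ring

open Polynomial in
lemma gp_deriv_of_ode (j a : ℕ)
    (h : Lop (a + 1) (derivative (gp j (a + 1))) =
      (-((j : ℝ) * (j + 2 * a + 3))) • gp j (a + 1)) :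
    derivative (gp (j + 1) a) = ((j : ℝ) + 1) • gp j (a + 1) := by
  have hc : (j : ℝ) + 2 * a + 2 ≠ 0 := by positivity
  rw [gp, derivative_smul, derivative_Lop, h, ← sub_smul, smul_smul]
  congr 1
  field_simp
  ring

open Polynomial in
lemma gp_ode (j : ℕ) : ∀ a : ℕ,
    Lop a (derivative (gp j a)) = (-((j : ℝ) * (j + 2 * a + 1))) • gp j a := by
  induction j with
  | zero => intro a; simp [gp, Lop]
  | succ j ih =>
    intro a
    have hc : (j : ℝ) + 2 * a + 2 ≠ 0 := by positivity
    rw [gp_deriv_of_ode j a (by rw [ih (a + 1)]; congr 1; push_cast; ring), gp, smul_smul]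
    have : Lop a (((j : ℝ) + 1) • gp j (a + 1)) = ((j : ℝ) + 1) • Lop a (gp j (a + 1)) := by
      simp [Lop, smul_eq_C_mul]; ring
    rw [this]
    congr 1
    push_cast
    field_simp
    ring

open Polynomial in
lemma gp_deriv (j a : ℕ) : derivative (gp (j + 1) a) = ((j : ℝ) + 1) • gp j (a + 1) :=
  gp_deriv_of_ode j a (by rw [gp_ode j (a + 1)]; congr 1; push_cast; ring)

open Polynomial in
lemma gp_parity (j : ℕ) : ∀ a : ℕ, (gp j a).comp (-X) = (-1 : ℝ) ^ j • gp j a := by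
  induction j with
  | zero => intro a; simp [gp]
  | succ j ih =>
    intro a
    have h1 := ih (a + 1)
    have h2 : (derivative (gp j (a + 1))).comp (-X) =
        (-1 : ℝ) ^ (j + 1) • derivative (gp j (a + 1)) := by
      have := congrArg derivative h1
      rw [derivative_comp, derivative_smul] at this
      simp at this
      rw [neg_eq_iff_eq_neg] at this
      rw [this, pow_succ]; simp
    rw [gp, smul_comp, Lop, sub_comp, smul_comp, mul_comp, mul_comp, h1, h2, smul_comm]
    congr 1
    simp [smul_eq_C_mul, pow_succ]
    ring

open Polynomial in
lemma gp_monic (j : ℕ) : ∀ a : ℕ, (gp j a).natDegree = j ∧ (gp j a).Monic := by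
  induction j with
  | zero => intro a; simp [gp]
  | succ j ih =>
    intro a
    have hc : (j : ℝ) + 2 * a + 2 ≠ 0 := by positivity
    obtain ⟨h1, h2⟩ := ih (a + 1)
    have hdeg : (gp (j + 1) a).natDegree ≤ j + 1 := by
      rw [gp]
      refine (natDegree_smul_le _ _).trans ?_
      rw [Lop]
      refine (natDegree_sub_le _ _).trans (max_le ?_ ?_)
      · rcases Nat.eq_zero_or_pos j with rfl | hj
        · rw [gp]; simp
        · refine natDegree_mul_le.trans ?_
          have e1 : (1 - X ^ 2 : ℝ[X]).natDegree ≤ 2 := by compute_degree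
          have e2 := natDegree_derivative_le (gp j (a + 1))
          omega
      · refine (natDegree_smul_le _ _).trans ?_
        refine natDegree_mul_le.trans ?_
        rw [h1, natDegree_X]; omega
    have hco : (gp (j + 1) a).coeff (j + 1) = 1 := by
      have h3 : (gp j (a + 1)).coeff j = 1 := by
        have := h2.coeff_natDegree; rwa [h1] at this
      have := congrArg (fun p => p.coeff j) (gp_deriv j a)
      simp only [coeff_derivative, coeff_smul, h3, smul_eq_mul, mul_one] at this
      have hj : (j : ℝ) + 1 ≠ 0 := by positivity
      exact mul_right_cancel₀ hj (by rw [this, one_mul])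
    exact ⟨natDegree_eq_of_le_of_coeff_ne_zero hdeg (by rw [hco]; norm_num),
      monic_of_natDegree_le_of_coeff_eq_one _ hdeg hco⟩

open Polynomial in
lemma gp_degree (j a : ℕ) : (gp j a).degree = j := by
  rw [degree_eq_natDegree (gp_monic j a).2.ne_zero, (gp_monic j a).1]

open Polynomial in
lemma gp_orth (j : ℕ) : ∀ (a : ℕ) (q : ℝ[X]), q.degree < j → Bf a (gp j a * q) = 0 := by
  induction j with
  | zero =>
    intro a q hq
    have : q = 0 := by
      rw [← degree_eq_bot]; simpa using hq
    simp [this]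
  | succ j ih =>
    intro a q hq
    have hc : (j : ℝ) + 2 * a + 2 ≠ 0 := by positivity
    have h := Bf_gp j a q
    rw [ih (a + 1)] at h
    · simpa [hc] using h
    · by_cases hq0 : q.natDegree = 0
      · rw [natDegree_eq_zero] at hq0
        obtain ⟨c, rfl⟩ := hq0
        simp
      · have h1 : q.natDegree < j + 1 := by
          rw [natDegree_lt_iff_degree_lt]; exact_mod_cast hq
          intro h; simp [h] at hq0
        have h2 := natDegree_derivative_lt hq0
        exact degree_le_natDegree.trans_lt (by exact_mod_cast (by omega))

/-- squared norms -/
noncomputable def hN (j a : ℕ) : ℝ := Bf a (gp j a * gp j a)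

open Polynomial in
lemma Bf_gp_monic (j a : ℕ) (q : ℝ[X]) (hq : q.Monic) (hd : q.natDegree = j) :
    Bf a (gp j a * q) = hN j a := by
  have hdeg : q.degree = j := by rw [degree_eq_natDegree hq.ne_zero, hd]
  have h := gp_orth j a (q - gp j a) (by
    rw [← hdeg]
    apply degree_sub_lt_left
    · rw [gp_degree, hdeg]
    · exact hq.ne_zero
    · rw [hq.leadingCoeff, (gp_monic j a).2.leadingCoeff])
  rw [mul_sub, map_sub] at h
  unfold hN; linarith

open Polynomial in
lemma Bf_neg (a : ℕ) (f : ℝ[X]) (hf : f.comp (-X) = -f) : Bf a f = 0 := by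
  have h1 : Bf a (f.comp (-X)) = Bf a f := by
    rw [Bf_apply, Bf_apply]
    have := intervalIntegral.integral_comp_neg (a := (-1 : ℝ)) (b := 1)
      (fun x : ℝ => f.eval x * (1 - x ^ 2) ^ a)
    rw [neg_neg] at this
    rw [← this]
    congr 1; ext x; simp
  rw [hf, map_neg] at h1
  linarith

lemma hN_succ (j a : ℕ) :
    ((j : ℝ) + 2 * a + 2) * hN (j + 1) a = (j + 1) * hN j (a + 1) := by
  rw [hN, Bf_gp, gp_deriv, mul_smul_comm, map_smul, smul_eq_mul, hN]

open Polynomial in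
lemma Bf_one_succ (a : ℕ) : (2 * (a : ℝ) + 3) * Bf (a + 1) 1 = 2 * (a + 1) * Bf a 1 := by
  have h := Bf_Lop a X
  have e : Lop a X = (2 * (a : ℝ) + 3) • ((1 - X ^ 2) * 1) - (2 * ((a : ℝ) + 1)) • (1 : ℝ[X]) := by
    simp [Lop, smul_eq_C_mul]
    have : (C 2 : ℝ[X]) = 2 := rfl
    have : (C 3 : ℝ[X]) = 3 := rfl
    simp [*]
    ring
  rw [e, map_sub, map_smul, map_smul, ← Bf_succ] at h
  simp only [smul_eq_mul] at h
  linarith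

lemma Bf_one_pos (a : ℕ) : 0 < Bf a 1 := by
  induction a with
  | zero => rw [Bf_apply]; norm_num
  | succ a ih =>
    have h := Bf_one_succ a
    have : 0 < 2 * ((a : ℝ) + 1) * Bf a 1 := by positivity
    rw [← h] at this
    exact pos_of_mul_pos_right this (by positivity)

lemma hN_zero (a : ℕ) : hN 0 a = Bf a 1 := by simp [hN, gp]

lemma hN_pos (j : ℕ) : ∀ a, 0 < hN j a := by
  induction j with
  | zero => intro a; rw [hN_zero]; exact Bf_one_pos a
  | succ j ih =>
    intro a
    have h := hN_succ j a
    have : 0 < ((j : ℝ) + 1) * hN j (a + 1) := mul_pos (by positivity) (ih _)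
    rw [← h] at this
    exact pos_of_mul_pos_right this (by positivity)

open Polynomial in
lemma gp_one (a : ℕ) : gp 1 a = X := by
  have hc : 2 * (a : ℝ) + 2 ≠ 0 := by positivity
  rw [gp, gp, Lop]
  simp only [derivative_one, mul_zero, zero_sub, mul_one, Nat.cast_zero, zero_add, ← neg_smul,
    smul_smul]
  have : -1 / (2 * (a : ℝ) + 2) * -(2 * ((a : ℝ) + 1)) = 1 := by field_simp
  rw [this, one_smul]

/-- `T[p_j²]` -/
noncomputable def tN (j a : ℕ) : ℝ := Tf a (gp j a * gp j a)
/-- `T[p_{j+1} p_j]` -/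
noncomputable def sN (j a : ℕ) : ℝ := Tf a (gp (j + 1) a * gp j a)
/-- harmonic numbers -/
noncomputable def HH (k : ℕ) : ℝ := ∑ j ∈ Finset.range k, 1 / (j + 1 : ℝ)

lemma HH_succ (k : ℕ) : HH (k + 1) = HH k + 1 / ((k : ℝ) + 1) := by
  simp [HH, Finset.sum_range_succ]

open Polynomial in
lemma tN_succ (j a : ℕ) :
    ((j : ℝ) + 2 * a + 2) * tN (j + 1) a = - hN (j + 1) a + (j + 1) * tN j (a + 1) := by
  rw [tN, Tf_gp, gp_deriv, mul_smul_comm, map_smul, smul_eq_mul, ← tN]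
  congr 1
  have e : (1 - X) * (gp j (a + 1) * gp (j + 1) a) =
    gp (j + 1) a * gp j (a + 1) - gp (j + 1) a * (X * gp j (a + 1)) := by ring
  rw [e, map_sub, gp_orth, Bf_gp_monic]
  · simp
  · exact monic_X.mul (gp_monic _ _).2
  · rw [natDegree_X_mul (gp_monic _ _).2.ne_zero, (gp_monic _ _).1]
  · rw [gp_degree]; exact_mod_cast Nat.lt_succ_self j

open Polynomial in
lemma cross_parity (j a b : ℕ) : Bf a (gp j a * (X * gp j b)) = 0 := by
  apply Bf_neg
  simp only [mul_comp, gp_parity, X_comp]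
  rw [neg_mul, mul_smul_comm, ← smul_neg, smul_mul_smul, ← mul_pow]
  simp

open Polynomial in
lemma sN_eq (j : ℕ) : ∀ a : ℕ, sN j a = (j + 1) / (2 * (j + a + 1)) * hN j a := by
  induction j with
  | zero =>
    intro a
    have hc : 2 * (a : ℝ) + 2 ≠ 0 := by positivity
    have h := Tf_gp 0 a 1
    simp only [gp, derivative_one, mul_zero, map_zero, mul_one, add_zero,
      Nat.cast_zero, zero_add, map_sub] at h
    have h2 : Bf a X = 0 := by apply Bf_neg; simp
    have h3 : Tf a (gp 1 a) = sN 0 a := by simp [sN, gp]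
    rw [hN_zero]
    simp only [h2, sub_zero] at h
    rw [← h, ← h3]
    simp [gp]
    field_simp
  | succ j ih =>
    intro a
    have h := Tf_gp (j + 1) a (gp (j + 1) a)
    rw [gp_deriv, mul_smul_comm, map_smul, smul_eq_mul] at h
    have e : (1 - X) * (gp (j + 1) (a + 1) * gp (j + 1) a) =
      gp (j + 1) a * gp (j + 1) (a + 1) - gp (j + 1) a * (X * gp (j + 1) (a + 1)) := by ring
    rw [e, map_sub, cross_parity, Bf_gp_monic _ _ _ (gp_monic _ _).2 (gp_monic _ _).1] at h
    change _ * sN (j + 1) a = _ + _ * sN j (a + 1) at h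
    rw [ih] at h
    have h2 := hN_succ j a
    have h3 : hN j (a + 1) = ((j : ℝ) + 2 * a + 2) * hN (j + 1) a / (j + 1) := by
      rw [h2]; field_simp
    rw [h3] at h
    have hc : ((j + 1 : ℕ) : ℝ) + 2 * a + 2 ≠ 0 := by positivity
    apply mul_left_cancel₀ hc
    rw [h]
    push_cast
    have : (j : ℝ) + a + 2 ≠ 0 := by positivity
    field_simp
    ring

open Polynomial in
lemma Tf_zero_one : Tf 0 1 = -2 := by
  rw [Tf_apply]
  simp only [eval_one, pow_zero, mul_one, one_mul]
  have := intervalIntegral.integral_comp_mul_add (a := (-1 : ℝ)) (b := 1) Real.log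
    (c := 1 / 2) (by norm_num) (1 / 2)
  have e : ∀ x : ℝ, (1 + x) / 2 = 1 / 2 * x + 1 / 2 := fun x => by ring
  simp only [e]
  rw [this, integral_log]
  norm_num

open Polynomial in
lemma tN_zero (a : ℕ) : tN 0 a = (HH a - HH (2 * a + 1)) * Bf a 1 := by
  have e0 : ∀ a, tN 0 a = Tf a 1 := fun a => by simp [tN, gp]
  rw [e0]
  induction a with
  | zero => rw [Tf_zero_one, Bf_apply]; norm_num [HH]
  | succ a ih =>
    have h := Tf_Lop a X
    have e : Lop a X =
        (2 * (a : ℝ) + 3) • ((1 - X ^ 2) * 1) - (2 * ((a : ℝ) + 1)) • (1 : ℝ[X]) := by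
      have h2 : (C 2 : ℝ[X]) = 2 := rfl
      have h3 : (C 3 : ℝ[X]) = 3 := rfl
      simp [Lop, smul_eq_C_mul, h2, h3]
      ring
    have e2 : (1 - X) * X = X + ((1 - X ^ 2) * 1 - (1 : ℝ[X])) := by ring
    have h2 : Bf a X = 0 := by apply Bf_neg; simp
    rw [e, map_sub, map_smul, map_smul, ← Tf_succ, e2, map_add, map_sub, ← Bf_succ, h2, ih] at h
    simp only [smul_eq_mul] at h
    have hB := Bf_one_succ a
    have hB' : Bf a 1 = (2 * (a : ℝ) + 3) * Bf (a + 1) 1 / (2 * (a + 1)) := by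
      rw [hB]; field_simp
    rw [hB'] at h
    have hc : 2 * (a : ℝ) + 3 ≠ 0 := by positivity
    apply mul_left_cancel₀ hc
    rw [show 2 * (a + 1) + 1 = 2 * a + 1 + 1 + 1 by ring, HH_succ (2 * a + 1 + 1),
      HH_succ (2 * a + 1), HH_succ a]
    rw [sub_eq_iff_eq_add] at h
    rw [h]
    push_cast
    have : 2 * (a : ℝ) + 1 + 1 ≠ 0 := by positivity
    have : 2 * (a : ℝ) + 1 + 1 + 1 ≠ 0 := by positivity
    field_simp
    ring

lemma tN_eq (j : ℕ) : ∀ a : ℕ, tN j a =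
    (HH (a + j) - HH (2 * a + 2 * j + 1) - HH (2 * a + 2 * j) + HH (j + 2 * a)) * hN j a := by
  induction j with
  | zero => intro a; rw [tN_zero, hN_zero]; simp
  | succ j ih =>
    intro a
    have h := tN_succ j a
    rw [ih] at h
    have h2 := hN_succ j a
    have h3 : hN j (a + 1) = ((j : ℝ) + 2 * a + 2) * hN (j + 1) a / (j + 1) := by
      rw [h2]; field_simp
    rw [h3] at h
    have hc : (j : ℝ) + 2 * a + 2 ≠ 0 := by positivity
    have hc' : (j : ℝ) + 2 * a + 1 + 1 ≠ 0 := by positivity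
    apply mul_left_cancel₀ hc
    rw [h, show a + 1 + j = a + (j + 1) by ring,
      show 2 * (a + 1) + 2 * j = 2 * a + 2 * (j + 1) by ring,
      show j + 2 * (a + 1) = (j + 1 + 2 * a) + 1 by ring, HH_succ (j + 1 + 2 * a)]
    push_cast
    have : (j : ℝ) + 1 + 2 * a + 1 ≠ 0 := by positivity
    field_simp
    ring

open Polynomial in
lemma eq_zero_of_orth (a N : ℕ) (f : ℝ[X]) (hf : f.degree < N)
    (h : ∀ k < N, Bf a (gp k a * f) = 0) : f = 0 := by
  by_contra hne
  have hk : f.natDegree < N := (natDegree_lt_iff_degree_lt hne).2 hf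
  have h1 := h _ hk
  have hm := monic_mul_leadingCoeff_inv hne
  have h2 := Bf_gp_monic f.natDegree a _ hm (natDegree_mul_leadingCoeff_inv f hne)
  rw [← mul_assoc, mul_comm, ← smul_eq_C_mul, map_smul, h1, smul_zero] at h2
  exact (hN_pos _ _).ne h2

open Polynomial in
lemma three_term (j a : ℕ) :
    X * gp (j + 1) a = gp (j + 2) a + (hN (j + 1) a / hN j a) • gp j a := by
  set b := hN (j + 1) a / hN j a with hb
  have hpos := hN_pos j a
  suffices h : X * gp (j + 1) a - gp (j + 2) a - b • gp j a = 0 by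
    rw [sub_sub, sub_eq_zero] at h; exact h
  apply eq_zero_of_orth a (j + 2)
  · refine (degree_sub_le _ _).trans_lt (max_lt ?_ ?_)
    · have hdX : (X * gp (j + 1) a).degree = ((j + 2 : ℕ) : WithBot ℕ) := by
        rw [degree_mul, degree_X, gp_degree]; push_cast; ring
      rw [← hdX]
      apply degree_sub_lt_left
      · rw [hdX, gp_degree]
      · exact (monic_X.mul (gp_monic _ _).2).ne_zero
      · rw [(monic_X.mul (gp_monic _ _).2).leadingCoeff, (gp_monic _ _).2.leadingCoeff]
    · refine (degree_smul_le _ _).trans_lt ?_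
      rw [gp_degree]; exact_mod_cast (by omega)
  · intro k hk
    have e : gp k a * (X * gp (j + 1) a - gp (j + 2) a - b • gp j a) =
      gp k a * (X * gp (j + 1) a) - gp (j + 2) a * gp k a - b • (gp j a * gp k a) := by
      rw [smul_eq_C_mul, smul_eq_C_mul]; ring
    rw [e, map_sub, map_sub, map_smul, gp_orth (j + 2) a (gp k a)
      (by rw [gp_degree]; exact_mod_cast hk)]
    rcases Nat.lt_trichotomy k j with hlt | rfl | hgt
    · rw [gp_orth j a (gp k a) (by rw [gp_degree]; exact_mod_cast hlt)]
      rw [show gp k a * (X * gp (j + 1) a) = gp (j + 1) a * (X * gp k a) by ring, gp_orth]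
      · simp
      · rw [degree_mul, degree_X, gp_degree]; exact_mod_cast (by omega)
    · rw [show gp k a * (X * gp (k + 1) a) = gp (k + 1) a * (X * gp k a) by ring, Bf_gp_monic, ← hN,
        hb, smul_eq_mul]
      · field_simp; ring
      · exact monic_X.mul (gp_monic _ _).2
      · rw [natDegree_X_mul (gp_monic _ _).2.ne_zero, (gp_monic _ _).1]
    · obtain rfl : k = j + 1 := by omega
      rw [cross_parity, mul_comm (gp j a), gp_orth (j + 1) a (gp j a)]
      · simp
      · rw [gp_degree]; exact_mod_cast (by omega)

/-- The value of the normalised one-level integral. -/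
noncomputable def JJ (j a : ℕ) : ℝ :=
  HH (a + j) - HH (2 * a + 2 * j + 1) - HH (2 * a + 2 * j) + HH (j + 2 * a)
    + ((j : ℝ) + 1) / (2 * (j + a + 1)) + j / (2 * (j + a))

open Polynomial in
lemma Tf_main (j a : ℕ) : Tf a ((1 + X) * (gp j a * gp j a)) = JJ j a * hN j a := by
  rw [add_mul, map_add, one_mul, ← tN, tN_eq]
  rcases j with _ | j
  · rw [show X * (gp 0 a * gp 0 a) = gp (0 + 1) a * gp 0 a by rw [zero_add, gp_one]; simp [gp],
      ← sN, sN_eq, JJ]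
    simp
    ring
  · rw [← mul_assoc, three_term, add_mul (gp (j + 2) a), map_add, ← sN, sN_eq, smul_mul_assoc, map_smul,
      mul_comm (gp j a), ← sN, sN_eq, JJ, smul_eq_mul]
    have := (hN_pos j a).ne'
    push_cast
    have h1 : (j : ℝ) + a + 1 ≠ 0 := by positivity
    have h2 : (j : ℝ) + 1 + a ≠ 0 := by positivity
    have h3 : (j : ℝ) + 1 + a + 1 ≠ 0 := by positivity
    field_simp
    ring

section Andreief
variable {m : ℕ}

lemma andreief (F : Fin m → ℝ → ℝ) (q : Fin m → ℝ → ℝ)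
    (hI : ∀ i k l, Integrable (fun x => F i x * (q k x * q l x))) :
    (Integrable fun x : Fin m → ℝ =>
      (∏ i, F i (x i)) * (Matrix.of fun i j => q j (x i)).det ^ 2) ∧
    ∫ x : Fin m → ℝ, (∏ i, F i (x i)) * (Matrix.of fun i j => q j (x i)).det ^ 2 =
      ∑ σ : Equiv.Perm (Fin m), ∑ τ : Equiv.Perm (Fin m),
        ((Equiv.Perm.sign σ : ℤ) : ℝ) * ((Equiv.Perm.sign τ : ℤ) : ℝ) *
          ∏ i, ∫ x, F i x * (q (σ i) x * q (τ i) x) := by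
  have e : (fun x : Fin m → ℝ => (∏ i, F i (x i)) * (Matrix.of fun i j => q j (x i)).det ^ 2) =
      fun x => ∑ σ : Equiv.Perm (Fin m), ∑ τ : Equiv.Perm (Fin m),
        ((Equiv.Perm.sign σ : ℤ) : ℝ) * ((Equiv.Perm.sign τ : ℤ) : ℝ) *
          ∏ i, F i (x i) * (q (σ i) (x i) * q (τ i) (x i)) := by
    ext x
    rw [← Matrix.det_transpose, Matrix.det_apply', sq, Finset.sum_mul_sum, Finset.mul_sum]
    refine Finset.sum_congr rfl fun σ _ => ?_
    rw [Finset.mul_sum]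
    refine Finset.sum_congr rfl fun τ _ => ?_
    rw [Finset.prod_mul_distrib, Finset.prod_mul_distrib]
    simp only [Matrix.transpose_apply, Matrix.of_apply]
    ring
  have hint : ∀ σ τ : Equiv.Perm (Fin m), Integrable (fun x : Fin m → ℝ =>
      ((Equiv.Perm.sign σ : ℤ) : ℝ) * ((Equiv.Perm.sign τ : ℤ) : ℝ) *
          ∏ i, F i (x i) * (q (σ i) (x i) * q (τ i) (x i))) := by
    intro σ τ
    apply Integrable.const_mul
    exact Integrable.fintype_prod (f := fun i x => F i x * (q (σ i) x * q (τ i) x))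
      (fun i => hI i _ _)
  rw [e]
  refine ⟨integrable_finsetSum _ fun σ _ => integrable_finsetSum _ fun τ _ => hint σ τ, ?_⟩
  rw [integral_finsetSum _ fun σ _ => integrable_finsetSum _ fun τ _ => hint σ τ]
  refine Finset.sum_congr rfl fun σ _ => ?_
  rw [integral_finsetSum _ fun τ _ => hint σ τ]
  refine Finset.sum_congr rfl fun τ _ => ?_
  rw [integral_const_mul]
  congr 1
  exact integral_fintype_prod_volume_eq_prod (fun i x => F i x * (q (σ i) x * q (τ i) x))

lemma sign_mul_self_real (σ : Equiv.Perm (Fin m)) :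
    ((Equiv.Perm.sign σ : ℤ) : ℝ) * ((Equiv.Perm.sign σ : ℤ) : ℝ) = 1 := by
  rcases Int.units_eq_one_or (Equiv.Perm.sign σ) with h | h <;> simp [h]

lemma perm_ne_off (σ τ : Equiv.Perm (Fin m)) (h : σ ≠ τ) (k : Fin m) :
    ∃ i, i ≠ k ∧ σ i ≠ τ i := by
  by_contra hc
  push Not at hc
  apply h
  ext i
  by_cases hi : i = k
  · subst hi
    obtain ⟨l, hl⟩ := τ.surjective (σ i)
    by_cases hli : l = i
    · rw [← hl, hli]
    · have := hc l hli
      rw [hl] at this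
      exact absurd (σ.injective this) hli
  · rw [hc i hi]

variable (φ g : ℝ → ℝ) (q : Fin m → ℝ → ℝ) (h : Fin m → ℝ)

lemma andreief_Z (hI : ∀ k l, Integrable (fun x => φ x * (q k x * q l x)))
    (ho : ∀ k l, ∫ x, φ x * (q k x * q l x) = if k = l then h k else 0) :
    ∫ x : Fin m → ℝ, (∏ i, φ (x i)) * (Matrix.of fun i j => q j (x i)).det ^ 2 =
      (Nat.factorial m : ℝ) * ∏ i, h i := by
  rw [(andreief (fun _ => φ) q (fun _ => hI)).2]
  have : ∀ σ : Equiv.Perm (Fin m), ∑ τ : Equiv.Perm (Fin m),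
        ((Equiv.Perm.sign σ : ℤ) : ℝ) * ((Equiv.Perm.sign τ : ℤ) : ℝ) *
          ∏ i, ∫ x, φ x * (q (σ i) x * q (τ i) x) = ∏ i, h i := by
    intro σ
    rw [Finset.sum_eq_single σ]
    · rw [sign_mul_self_real, one_mul]
      simp only [ho, if_true]
      exact Equiv.prod_comp σ h
    · intro τ _ hne
      obtain ⟨i, hi⟩ : ∃ i, σ i ≠ τ i := by
        by_contra hc; push Not at hc
        exact hne (Equiv.ext fun i => (hc i).symm)
      rw [Finset.prod_eq_zero (Finset.mem_univ i), mul_zero]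
      rw [ho, if_neg hi]
    · simp
  simp only [this]
  simp [Fintype.card_perm]

lemma andreief_lin (G : Fin m → ℝ) (hh : ∀ i, h i ≠ 0)
    (hI : ∀ k l, Integrable (fun x => φ x * (q k x * q l x)))
    (hIg : ∀ k l, Integrable (fun x => (g x * φ x) * (q k x * q l x)))
    (ho : ∀ k l, ∫ x, φ x * (q k x * q l x) = if k = l then h k else 0)
    (hG : ∀ k, ∫ x, (g x * φ x) * (q k x * q k x) = G k) :
    ∫ x : Fin m → ℝ, (∑ i, g (x i)) *
      ((∏ i, φ (x i)) * (Matrix.of fun i j => q j (x i)).det ^ 2) =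
      (Nat.factorial m : ℝ) * (∏ i, h i) * ∑ i, G i / h i := by
  classical
  set F : Fin m → Fin m → ℝ → ℝ := fun k i x => if i = k then g x * φ x else φ x with hF
  have hFI : ∀ k i a b, Integrable (fun x => F k i x * (q a x * q b x)) := by
    intro k i a b
    by_cases hik : i = k
    · simp only [hF, hik, if_true]; exact hIg a b
    · simp only [hF, hik, if_false]; exact hI a b
  have e1 : (fun x : Fin m → ℝ => (∑ i, g (x i)) *
      ((∏ i, φ (x i)) * (Matrix.of fun i j => q j (x i)).det ^ 2)) =
      fun x => ∑ k, (∏ i, F k i (x i)) * (Matrix.of fun i j => q j (x i)).det ^ 2 := by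
    ext x
    rw [Finset.sum_mul]
    refine Finset.sum_congr rfl fun k _ => ?_
    rw [← mul_assoc]
    congr 1
    rw [← Finset.mul_prod_erase _ _ (Finset.mem_univ k), 
      ← Finset.mul_prod_erase _ (fun i => F k i (x i)) (Finset.mem_univ k), ← mul_assoc]
    congr 1
    · simp [hF]
    · refine Finset.prod_congr rfl fun i hi => ?_
      simp [hF, Finset.ne_of_mem_erase hi]
  rw [e1, integral_finsetSum _ fun k _ => (andreief (F k) q (hFI k)).1]
  have e2 : ∀ k, ∫ x : Fin m → ℝ, (∏ i, F k i (x i)) * (Matrix.of fun i j => q j (x i)).det ^ 2 =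
      ∑ σ : Equiv.Perm (Fin m), (∏ i, h i) * (G (σ k) / h (σ k)) := by
    intro k
    rw [(andreief (F k) q (hFI k)).2]
    refine Finset.sum_congr rfl fun σ _ => ?_
    rw [Finset.sum_eq_single σ]
    · rw [sign_mul_self_real, one_mul, ← Equiv.prod_comp σ h,
        ← Finset.mul_prod_erase _ _ (Finset.mem_univ k), 
        ← Finset.mul_prod_erase _ (fun i => h (σ i)) (Finset.mem_univ k)]
      have h1 : ∏ i ∈ Finset.univ.erase k, ∫ x, F k i x * (q (σ i) x * q (σ i) x) =
          ∏ i ∈ Finset.univ.erase k, h (σ i) := by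
        refine Finset.prod_congr rfl fun i hi => ?_
        simp only [hF, Finset.ne_of_mem_erase hi, if_false, ho, if_true]
      have h2 : ∫ x, F k k x * (q (σ k) x * q (σ k) x) = G (σ k) := by
        simp only [hF, if_true, hG]
      rw [h1, h2]
      have := hh (σ k)
      field_simp
    · intro τ _ hne
      obtain ⟨i, hik, hi⟩ := perm_ne_off σ τ hne.symm k
      rw [Finset.prod_eq_zero (Finset.mem_univ i), mul_zero]
      simp only [hF, hik, if_false, ho, hi]
    · simp
  simp only [e2]
  rw [Finset.sum_comm]
  have e3 : ∀ σ : Equiv.Perm (Fin m), ∑ k, (∏ i, h i) * (G (σ k) / h (σ k)) =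
      (∏ i, h i) * ∑ i, G i / h i := by
    intro σ
    rw [← Finset.mul_sum, Equiv.sum_comp σ (fun i => G i / h i)]
  simp only [e3]
  simp [Fintype.card_perm, mul_assoc]
end Andreief

open Polynomial in
lemma even_poly (a k : ℕ) : ∃ Q R : ℝ[X], Q.Monic ∧ Q.natDegree = k ∧ R.Monic ∧ R.natDegree = k ∧
    (∀ x, (gp (2 * k) a).eval x = Q.eval (x ^ 2)) ∧
    (∀ x, (gp (2 * k + 1) a).eval x = x * R.eval (x ^ 2)) := by
  have step : ∀ (A B : ℝ[X]) (N : ℕ) (c : ℝ), A.Monic → A.natDegree = N + 1 → B.natDegree = N →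
      (A - C c * B).Monic ∧ (A - C c * B).natDegree = N + 1 := by
    intro A B N c hA hAd hB
    have hlt : (C c * B).degree < A.degree := by
      rw [degree_eq_natDegree hA.ne_zero, hAd]
      refine degree_le_natDegree.trans_lt ?_
      have := natDegree_C_mul_le c B
      exact_mod_cast (by omega)
    refine ⟨hA.sub_of_left hlt, ?_⟩
    rw [natDegree_sub_eq_left_of_natDegree_lt, hAd]
    have := natDegree_C_mul_le c B
    omega
  induction k with
  | zero => exact ⟨1, 1, by simp, by simp, by simp, by simp, by simp [gp], by simp [gp_one]⟩
  | succ k ih =>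
    obtain ⟨Q, R, hQ, hQd, hR, hRd, h1, h2⟩ := ih
    obtain ⟨s1, s2⟩ := step (X * R) Q k (hN (2 * k + 1) a / hN (2 * k) a) (monic_X.mul hR)
      (by rw [natDegree_X_mul hR.ne_zero, hRd]) hQd
    obtain ⟨s3, s4⟩ := step _ R k (hN (2 * k + 2) a / hN (2 * k + 1) a) s1 s2 hRd
    have h3 : ∀ x, (gp (2 * (k + 1)) a).eval x =
        (X * R - C (hN (2 * k + 1) a / hN (2 * k) a) * Q).eval (x ^ 2) := by
      intro x
      have := congrArg (eval x) (three_term (2 * k) a)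
      simp only [eval_mul, eval_X, eval_add, eval_smul, smul_eq_mul, h1, h2] at this
      rw [show 2 * (k + 1) = 2 * k + 2 by ring]
      simp only [eval_mul, eval_X, eval_sub, eval_C]
      linarith
    refine ⟨_, _, s1, s2, s3, s4, h3, ?_⟩
    intro x
    have := congrArg (eval x) (three_term (2 * k + 1) a)
    rw [show 2 * k + 1 + 1 = 2 * (k + 1) by ring, show 2 * k + 1 + 2 = 2 * (k + 1) + 1 by ring] at this
    simp only [eval_mul, eval_X, eval_add, eval_smul, smul_eq_mul, h3, h2] at this
    rw [eval_sub, mul_sub, this, show 2 * (k + 1) = 2 * k + 2 by ring]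
    simp only [eval_mul, eval_C]
    ring

/-- the weight on the unit interval -/
noncomputable def phiW (a : ℕ) : ℝ → ℝ := Set.indicator (Set.Icc 0 1) fun x => (1 - x ^ 2) ^ a

open Polynomial in
lemma density_eq (m n : ℕ) (x : Fin m → ℝ) :
    densityA m n x = (∏ i, phiW (n - m) (x i)) *
      (Matrix.of fun i j : Fin m => (gp (2 * (j : ℕ)) (n - m)).eval (x i)).det ^ 2 := by
  unfold densityA
  split_ifs with hx
  · rw [mul_comm]
    congr 1
    · refine Finset.prod_congr rfl fun i _ => ?_
      rw [phiW, Set.indicator_of_mem (hx i)]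
    · choose Q R hQ hQd hR hRd h1 h2 using even_poly (n - m)
      have e := Matrix.det_eval_matrixOfPolynomials_eq_det_vandermonde (fun i => x i ^ 2)
        (fun j : Fin m => Q j) (fun j => hQd j) (fun j => hQ j)
      have e2 : (Matrix.of fun i j : Fin m => (gp (2 * (j : ℕ)) (n - m)).eval (x i)) =
          Matrix.of fun i j : Fin m => (Q j).eval (x i ^ 2) := by
        ext i j; simp [h1]
      rw [e2, ← e, Matrix.det_vandermonde, ← Finset.prod_pow, Finset.prod_filter,
        ← Finset.univ_product_univ, Finset.prod_product]
      refine Finset.prod_congr rfl fun i _ => ?_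
      rw [← Finset.prod_pow, ← Finset.prod_filter]
      refine Finset.prod_congr ?_ fun j _ => by ring
      ext j; simp
  · push Not at hx
    obtain ⟨i, hi⟩ := hx
    rw [Finset.prod_eq_zero (Finset.mem_univ i), zero_mul]
    rw [phiW, Set.indicator_of_notMem hi]

lemma vEnt_cont : Continuous vEnt := by
  have h1 : Continuous (fun x : ℝ => ((1 + x) / 2) * Real.log ((1 + x) / 2)) :=
    Real.continuous_mul_log.comp (f := fun x : ℝ => (1 + x) / 2) (by fun_prop)
  have h2 : Continuous (fun x : ℝ => ((1 - x) / 2) * Real.log ((1 - x) / 2)) :=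
    Real.continuous_mul_log.comp (f := fun x : ℝ => (1 - x) / 2) (by fun_prop)
  exact h2.add h1

lemma phiW_mul (a : ℕ) (f : ℝ → ℝ) : (fun x => phiW a x * f x) =
    Set.indicator (Set.Icc 0 1) (fun x => f x * (1 - x ^ 2) ^ a) := by
  ext x
  by_cases hx : x ∈ Set.Icc (0 : ℝ) 1
  · simp only [phiW, Set.indicator_of_mem hx]; ring
  · simp only [phiW, Set.indicator_of_notMem hx, zero_mul]

lemma phiW_int (a : ℕ) (f : ℝ → ℝ) (hf : Continuous f) : Integrable (fun x => phiW a x * f x) := by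
  rw [phiW_mul, integrable_indicator_iff measurableSet_Icc]
  apply Continuous.integrableOn_Icc
  fun_prop

lemma phiW_integral (a : ℕ) (f : ℝ → ℝ) :
    ∫ x, phiW a x * f x = ∫ x in (0 : ℝ)..1, f x * (1 - x ^ 2) ^ a := by
  rw [phiW_mul, integral_indicator measurableSet_Icc, intervalIntegral.integral_of_le (by norm_num),
    integral_Icc_eq_integral_Ioc]

lemma sym_int (f : ℝ → ℝ) (hf : Continuous f) :
    ∫ x in (-1 : ℝ)..1, f x = ∫ x in (0 : ℝ)..1, (f x + f (-x)) := by
  have hf2 : Continuous (fun x => f (-x)) := by fun_prop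
  rw [intervalIntegral.integral_add (hf.intervalIntegrable _ _)
    (hf2.intervalIntegrable _ _), intervalIntegral.integral_comp_neg]
  rw [← intervalIntegral.integral_add_adjacent_intervals (b := 0) (hf.intervalIntegrable _ _)
    (hf.intervalIntegrable _ _)]
  simp; ring

open Polynomial in
lemma gp_even_eval (a k : ℕ) (x : ℝ) : (gp (2 * k) a).eval (-x) = (gp (2 * k) a).eval x := by
  obtain ⟨Q, R, _, _, _, _, h, _⟩ := even_poly a k
  rw [h, h]; simp

open Polynomial in
lemma ortho_half (a k l : ℕ) :
    ∫ x, phiW a x * ((gp (2 * k) a).eval x * (gp (2 * l) a).eval x) =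
      if k = l then hN (2 * k) a / 2 else 0 := by
  have h1 : Bf a (gp (2 * k) a * gp (2 * l) a) =
      2 * ∫ x, phiW a x * ((gp (2 * k) a).eval x * (gp (2 * l) a).eval x) := by
    rw [phiW_integral, Bf_apply, sym_int _ (by fun_prop), ← intervalIntegral.integral_const_mul]
    congr 1; ext x
    simp only [eval_mul, gp_even_eval]
    ring
  split_ifs with h
  · subst h
    rw [hN, h1]; ring
  · have : Bf a (gp (2 * k) a * gp (2 * l) a) = 0 := by
      rcases lt_or_gt_of_ne h with h | h
      · rw [mul_comm]; apply gp_orth; rw [gp_degree]; exact_mod_cast (by omega)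
      · apply gp_orth; rw [gp_degree]; exact_mod_cast (by omega)
    linarith

open Polynomial in
lemma vEnt_half (a k : ℕ) :
    ∫ x, vEnt x * phiW a x * ((gp (2 * k) a).eval x * (gp (2 * k) a).eval x) =
      JJ (2 * k) a * (hN (2 * k) a / 2) := by
  have h1 := Tf_main (2 * k) a
  have e : (fun x => vEnt x * phiW a x * ((gp (2 * k) a).eval x * (gp (2 * k) a).eval x)) =
    fun x => phiW a x * (vEnt x * ((gp (2 * k) a).eval x * (gp (2 * k) a).eval x)) := by
    ext x; ring
  have hc : Continuous (fun x : ℝ => ((1 + x) / 2) * Real.log ((1 + x) / 2)) :=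
    Real.continuous_mul_log.comp (f := fun x : ℝ => (1 + x) / 2) (by fun_prop)
  have e2 : Tf a ((1 + X) * (gp (2 * k) a * gp (2 * k) a)) = ∫ x in (-1 : ℝ)..1,
      2 * (((1 + x) / 2) * Real.log ((1 + x) / 2)) *
        ((gp (2 * k) a).eval x * (gp (2 * k) a).eval x * (1 - x ^ 2) ^ a) := by
    rw [Tf_apply]; congr 1; ext x
    simp only [eval_mul, eval_add, eval_X, eval_one]
    ring
  rw [sym_int _ (by fun_prop)] at e2
  rw [e, phiW_integral]
  have e3 : Tf a ((1 + X) * (gp (2 * k) a * gp (2 * k) a)) =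
      2 * ∫ x in (0 : ℝ)..1, vEnt x * ((gp (2 * k) a).eval x * (gp (2 * k) a).eval x) *
        (1 - x ^ 2) ^ a := by
    rw [e2, ← intervalIntegral.integral_const_mul]
    congr 1; ext x
    simp only [gp_even_eval, vEnt, ← sub_eq_add_neg]
    ring
  linarith

lemma psi0_eq (k : ℕ) : psi0 k = -Real.eulerMascheroniConstant + HH (k - 1) := rfl

lemma final_sum (a m : ℕ) : -∑ k ∈ Finset.range m, JJ (2 * k) a =
    ((m : ℝ) + (m + a : ℕ) - 1 / 2) * psi0 (2 * m + 2 * (m + a)) + (1 / 4 - m) * psi0 (m + (m + a))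
        + (1 / 2 - (m + a : ℕ)) * psi0 (2 * (m + a)) - 1 / 4 * psi0 (m + a) - m := by
  induction m with
  | zero =>
    simp [psi0_eq]
    ring
  | succ m ih =>
    rw [Finset.sum_range_succ, neg_add, ih, JJ]
    rcases Nat.eq_zero_or_pos (m + a) with h0 | hpos
    · obtain ⟨rfl, rfl⟩ : m = 0 ∧ a = 0 := by omega
      norm_num [psi0_eq, HH, Finset.sum_range_succ]
      ring
    · simp only [psi0_eq]
      obtain ⟨c, hc⟩ : ∃ c, m + a = c + 1 := ⟨m + a - 1, by omega⟩
      have hcR : (m : ℝ) + a = c + 1 := by exact_mod_cast hc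
      have hA : (a : ℝ) = c + 1 - m := by linarith
      rw [show a + 2 * m = m + c + 1 by omega,
        show 2 * a + 2 * (2 * m) + 1 = 2 * m + 2 * c + 1 + 1 + 1 by omega,
        show 2 * a + 2 * (2 * m) = 2 * m + 2 * c + 1 + 1 by omega,
        show 2 * m + 2 * a = 2 * c + 1 + 1 by omega,
        show 2 * m + 2 * (m + a) - 1 = 2 * m + 2 * c + 1 by omega,
        show m + (m + a) - 1 = m + c by omega,
        show 2 * (m + a) - 1 = 2 * c + 1 by omega,
        show m + a - 1 = c by omega,
        show 2 * (m + 1) + 2 * (m + 1 + a) - 1 = 2 * m + 2 * c + 1 + 1 + 1 + 1 + 1 by omega,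
        show m + 1 + (m + 1 + a) - 1 = m + c + 1 + 1 by omega,
        show 2 * (m + 1 + a) - 1 = 2 * c + 1 + 1 + 1 by omega,
        show m + 1 + a - 1 = c + 1 by omega]
      simp only [HH_succ (2 * m + 2 * c + 1 + 1 + 1 + 1), HH_succ (2 * m + 2 * c + 1 + 1 + 1),
        HH_succ (2 * m + 2 * c + 1 + 1), HH_succ (2 * m + 2 * c + 1), HH_succ (m + c + 1),
        HH_succ (m + c), HH_succ (2 * c + 1 + 1), HH_succ (2 * c + 1), HH_succ c]
      push_cast
      rw [hA]
      generalize HH (2 * m + 2 * c + 1) = A1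
      generalize HH (m + c) = A2
      generalize HH (2 * c + 1) = A3
      generalize HH c = A4
      have d1 : (m : ℝ) + c + 1 ≠ 0 := by positivity
      have d2 : (m : ℝ) + c + 1 + 1 ≠ 0 := by positivity
      have d3 : 2 * (m : ℝ) + 2 * c + 1 + 1 ≠ 0 := by positivity
      have d4 : 2 * (m : ℝ) + 2 * c + 1 + 1 + 1 ≠ 0 := by positivity
      have d5 : 2 * (m : ℝ) + 2 * c + 1 + 1 + 1 + 1 ≠ 0 := by positivity
      have d6 : 2 * (m : ℝ) + 2 * c + 1 + 1 + 1 + 1 + 1 ≠ 0 := by positivity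
      have d7 : 2 * (c : ℝ) + 1 + 1 ≠ 0 := by positivity
      have d8 : 2 * (c : ℝ) + 1 + 1 + 1 ≠ 0 := by positivity
      have d9 : (c : ℝ) + 1 ≠ 0 := by positivity
      rw [show 2 * (m : ℝ) + (c + 1 - m) + 1 = m + c + 1 + 1 by ring,
        show 2 * (m : ℝ) + (c + 1 - m) = m + c + 1 by ring]
      field_simp
      ring

theorem mean_vonNeumann_entropy_caseA (m n : ℕ) (hm : 1 ≤ m) (hmn : m ≤ n) :
    ensembleAvg (densityA m n) entS =
      ((m : ℝ) + n - 1 / 2) * psi0 (2 * m + 2 * n) + (1 / 4 - m) * psi0 (m + n)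
        + (1 / 2 - n) * psi0 (2 * n) - 1 / 4 * psi0 n - m := by
  obtain ⟨a, rfl⟩ := Nat.exists_eq_add_of_le hmn
  rw [← final_sum a m]
  set q : Fin m → ℝ → ℝ := fun j x => (gp (2 * (j : ℕ)) a).eval x with hq
  set h : Fin m → ℝ := fun j => hN (2 * (j : ℕ)) a / 2 with hh
  have hpos : ∀ i, 0 < h i := fun i => half_pos (hN_pos _ _)
  have hqc : ∀ i, Continuous (q i) := fun i => (gp (2 * (i : ℕ)) a).continuous
  have hdens : densityA m (m + a) = fun x =>
      (∏ i, phiW a (x i)) * (Matrix.of fun i j => q j (x i)).det ^ 2 := by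
    ext x
    rw [density_eq, show m + a - m = a by omega]
  have hI : ∀ k l, Integrable (fun x => phiW a x * (q k x * q l x)) := fun k l =>
    phiW_int a _ ((hqc k).mul (hqc l))
  have hIg : ∀ k l, Integrable (fun x => (vEnt x * phiW a x) * (q k x * q l x)) := by
    intro k l
    have := phiW_int a _ (vEnt_cont.mul ((hqc k).mul (hqc l)))
    refine this.congr (Filter.Eventually.of_forall fun x => ?_)
    simp only [Pi.mul_apply]
    ring
  have ho : ∀ k l, ∫ x, phiW a x * (q k x * q l x) = if k = l then h k else 0 := by
    intro k l
    have := ortho_half a k l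
    simpa only [Fin.val_inj] using this
  have hZ := andreief_Z (phiW a) q h hI ho
  have hL := andreief_lin (phiW a) vEnt q h (fun k => JJ (2 * (k : ℕ)) a * h k)
    (fun i => (hpos i).ne') hI hIg ho (fun k => vEnt_half a k)
  unfold ensembleAvg
  rw [hdens]
  simp only [entS, neg_mul]
  rw [integral_neg, hL, hZ]
  have hZpos : (Nat.factorial m : ℝ) * ∏ i, h i ≠ 0 := by
    apply mul_ne_zero
    · exact_mod_cast Nat.factorial_ne_zero m
    · exact Finset.prod_ne_zero_iff.2 fun i _ => (hpos i).ne'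
  rw [neg_div, mul_div_cancel_left₀ _ hZpos]
  congr 1
  rw [Finset.sum_range]
  refine Finset.sum_congr rfl fun i _ => ?_
  rw [mul_div_cancel_right₀ _ (hpos i).ne']
end

section
/- Let 1 ≤ m ≤ p ≤ n be integers. For the fermionic Gaussian ensemble with fixed particle number p, the average of the von Neumann entropy equals E[S] = −(m(m+n−p)/(m+n))·ψ₀(m+n−p) + (m+n)·ψ₀(m+n+1) − (mp/(m+n))·ψ₀(p+1) − n·ψ₀(n+1) − m. -/
open MeasureTheory Real Finset

/-- The unnormalized fermionic-Gaussian eigenvalue density with fixed particle number `p`. -/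
noncomputable def densityB (m n p : ℕ) (x : Fin m → ℝ) : ℝ :=
  if ∀ i, x i ∈ Set.Icc (-1 : ℝ) 1 then
    (∏ q ∈ Finset.univ.filter (fun q : Fin m × Fin m => q.1 < q.2),
      ((x q.1) - (x q.2)) ^ 2) * ∏ i, (1 + x i) ^ (p - m) * (1 - x i) ^ (n - p)
  else 0

namespace JacEnt
open Polynomial

/-- Integral over `[0,1]` of a polynomial. -/
noncomputable def PI (P : ℝ[X]) : ℝ := ∫ t in (0:ℝ)..1, P.eval t

/-- Integral over `[0,1]` of a polynomial against `log t`. -/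
noncomputable def PL (P : ℝ[X]) : ℝ := ∫ t in (0:ℝ)..1, Real.log t * P.eval t

lemma ii_poly (P : ℝ[X]) (u v : ℝ) : IntervalIntegrable (fun t => P.eval t) volume u v :=
  P.continuous.intervalIntegrable u v

lemma ii_log (P : ℝ[X]) (u v : ℝ) :
    IntervalIntegrable (fun t => Real.log t * P.eval t) volume u v :=
  intervalIntegral.intervalIntegrable_log'.mul_continuousOn P.continuous.continuousOn

lemma PI_add (P Q : ℝ[X]) : PI (P + Q) = PI P + PI Q := by
  simp only [PI, eval_add]
  exact intervalIntegral.integral_add (ii_poly P 0 1) (ii_poly Q 0 1)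

lemma PI_C (c : ℝ) (P : ℝ[X]) : PI (C c * P) = c * PI P := by
  simp only [PI, eval_mul, eval_C]
  exact intervalIntegral.integral_const_mul _ _

lemma PL_add (P Q : ℝ[X]) : PL (P + Q) = PL P + PL Q := by
  simp only [PL, eval_add, mul_add]
  exact intervalIntegral.integral_add (ii_log P 0 1) (ii_log Q 0 1)

lemma PL_C (c : ℝ) (P : ℝ[X]) : PL (C c * P) = c * PL P := by
  simp only [PL, eval_mul, eval_C]
  rw [← intervalIntegral.integral_const_mul]
  congr 1; ext t; ring

lemma PI_deriv (P : ℝ[X]) : PI (derivative P) = P.eval 1 - P.eval 0 := by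
  unfold PI
  exact intervalIntegral.integral_eq_sub_of_hasDerivAt (fun x _ => P.hasDerivAt x)
    (ii_poly _ 0 1)

lemma PL_deriv (Q : ℝ[X]) : PL (derivative (X * Q)) = - PI Q := by
  have h : ∫ t in (0:ℝ)..1, (Real.log t * (derivative (X * Q)).eval t + Q.eval t) = 
      (1 * Real.log 1) * Q.eval 1 - (0 * Real.log 0) * Q.eval 0 := by
    refine intervalIntegral.integral_eq_sub_of_hasDerivAt_of_le (f := fun t => (t * Real.log t) * Q.eval t) zero_le_one
      (Real.continuous_mul_log.mul Q.continuous).continuousOn ?_ ?_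
    · intro x hx
      have hx0 : x ≠ 0 := ne_of_gt hx.1
      have h1 := (Real.hasDerivAt_log hx0).mul ((X * Q : ℝ[X]).hasDerivAt x)
      have e : (fun t => (t * Real.log t) * Q.eval t) = (fun t => Real.log t * (X * Q).eval t) := by
        ext t; simp; ring
      rw [e]
      refine HasDerivAt.congr_deriv h1 ?_
      rw [eval_mul, eval_X]
      field_simp
      ring
    · exact (ii_log _ 0 1).add (ii_poly _ 0 1)
  rw [intervalIntegral.integral_add (ii_log _ 0 1) (ii_poly _ 0 1)] at h
  simp only [Real.log_one, mul_zero, zero_mul, sub_zero] at h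
  unfold PL PI
  linarith

/-- Weight polynomial. -/
noncomputable def wt (a b : ℕ) : ℝ[X] := X ^ a * (1 - X) ^ b

/-- Monic Jacobi polynomials on `[0,1]`. -/
noncomputable def R : ℕ → ℕ → ℕ → ℝ[X]
  | 0, _, _ => 1
  | k + 1, a, b => C (-1 / ((a:ℝ) + b + k + 2)) *
      (X * (1 - X) * derivative (R k (a+1) (b+1)) +
        (C ((a:ℝ) + 1) - C ((a:ℝ) + b + 2) * X) * R k (a+1) (b+1))

lemma R_succ (k a b : ℕ) : C ((a:ℝ) + b + k + 2) * R (k+1) a b =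
    -(X * (1 - X) * derivative (R k (a+1) (b+1)) +
        (C ((a:ℝ) + 1) - C ((a:ℝ) + b + 2) * X) * R k (a+1) (b+1)) := by
  have h : (a:ℝ) + b + k + 2 ≠ 0 := by positivity
  rw [R, ← mul_assoc, ← C_mul]
  have : ((a:ℝ) + b + k + 2) * (-1 / ((a:ℝ) + b + k + 2)) = -1 := by field_simp
  rw [this]; simp

lemma wt_succ (a b : ℕ) : wt (a+1) (b+1) = X * (1 - X) * wt a b := by
  simp only [wt]; ring

lemma deriv_wt (a b : ℕ) : derivative (wt (a+1) (b+1)) =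
    (C ((a:ℝ) + 1) - C ((a:ℝ) + b + 2) * X) * wt a b := by
  simp only [wt, derivative_mul, derivative_pow, derivative_sub, derivative_one,
    derivative_X]
  simp only [Nat.add_sub_cancel, map_add, map_natCast, Nat.cast_add, Nat.cast_one, map_one, map_ofNat]
  ring

lemma raise (k a b : ℕ) : derivative (R k (a+1) (b+1) * wt (a+1) (b+1)) =
    - (C ((a:ℝ) + b + k + 2) * (R (k+1) a b * wt a b)) := by
  rw [← mul_assoc, R_succ, derivative_mul, deriv_wt, wt_succ]; ring

lemma deriv_R (k : ℕ) : ∀ a b : ℕ, derivative (R (k+1) a b) = C ((k:ℝ)+1) * R k (a+1) (b+1) := by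
  induction k with
  | zero =>
    intro a b
    have h : (a:ℝ) + b + (0:ℕ) + 2 ≠ 0 := by positivity
    have := congrArg derivative (R_succ 0 a b)
    apply mul_left_cancel₀ (C_ne_zero.mpr h)
    rw [derivative_C_mul] at this
    rw [this]; simp [R]
  | succ k ih =>
    intro a b
    have h : (a:ℝ) + b + (k+1:ℕ) + 2 ≠ 0 := by positivity
    have h1 := congrArg derivative (R_succ (k+1) a b)
    apply mul_left_cancel₀ (C_ne_zero.mpr h)
    rw [derivative_C_mul] at h1
    rw [h1, ih]
    have h2 := R_succ k (a+1) (b+1)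
    simp only [derivative_neg, derivative_add, derivative_mul, derivative_sub, derivative_X,
      derivative_C, derivative_one, ih]
    simp only [map_add, map_natCast, Nat.cast_add, Nat.cast_one, map_one, map_ofNat] at h2 ⊢
    linear_combination (-((k:ℝ[X])+1)) * h2

lemma R_coeff (k : ℕ) : ∀ a b : ℕ, (R k a b).coeff k = 1 ∧ ∀ N, k < N → (R k a b).coeff N = 0 := by
  induction k with
  | zero =>
    intro a b
    refine ⟨by simp [R], fun N hN => ?_⟩
    simp [R, coeff_one, hN.ne']
  | succ k ih =>
    intro a b
    have key : ∀ N, (R (k+1) a b).coeff (N+1) * ((N:ℝ)+1) = ((k:ℝ)+1) * (R k (a+1) (b+1)).coeff N := by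
      intro N
      have := congrArg (fun P => P.coeff N) (deriv_R k a b)
      simpa only [coeff_derivative, coeff_C_mul] using this
    constructor
    · have := key k
      rw [(ih _ _).1] at this
      have h0 : (k:ℝ)+1 ≠ 0 := by positivity
      apply mul_right_cancel₀ h0
      rw [this]; ring
    · intro N hN
      obtain ⟨M, rfl⟩ : ∃ M, N = M + 1 := ⟨N - 1, by omega⟩
      have := key M
      rw [(ih _ _).2 M (by omega)] at this
      have h0 : (M:ℝ)+1 ≠ 0 := by positivity
      simpa [h0] using this

lemma R_natDegree (k a b : ℕ) : (R k a b).natDegree = k := by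
  apply natDegree_eq_of_le_of_coeff_ne_zero
  · rw [natDegree_le_iff_coeff_eq_zero]
    exact (R_coeff k a b).2
  · rw [(R_coeff k a b).1]; exact one_ne_zero

lemma R_monic (k a b : ℕ) : (R k a b).Monic := by
  rw [Monic, leadingCoeff, R_natDegree, (R_coeff k a b).1]

lemma R_degree (k a b : ℕ) : (R k a b).degree = k := by
  rw [degree_eq_natDegree (R_monic k a b).ne_zero, R_natDegree]

lemma R_symm (k : ℕ) : ∀ a b : ℕ, (R k a b).comp (1 - X) = (-1) ^ k * R k b a := by
  induction k with
  | zero => intro a b; simp [R]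
  | succ k ih =>
    intro a b
    have h : (a:ℝ) + b + k + 2 ≠ 0 := by positivity
    apply mul_left_cancel₀ (C_ne_zero.mpr h)
    have h1 := congrArg (fun P => P.comp (1 - X)) (R_succ k a b)
    have h2 := R_succ k b a
    have h3 := ih (a+1) (b+1)
    have h4 : (derivative (R k (a+1) (b+1))).comp (1 - X) = - ((-1) ^ k * derivative (R k (b+1) (a+1))) := by
      have := congrArg derivative h3
      rw [derivative_comp] at this
      have e : derivative ((-1 : ℝ[X]) ^ k * R k (b+1) (a+1)) = (-1) ^ k * derivative (R k (b+1) (a+1)) := by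
        have : ((-1 : ℝ[X]) ^ k) = C ((-1) ^ k) := by simp
        rw [this, derivative_C_mul]
      rw [e] at this
      simp at this
      linear_combination -this
    simp only [mul_comp, add_comp, sub_comp, neg_comp, C_comp, X_comp, one_comp, h3, h4] at h1
    rw [h1]
    simp only [map_add, map_natCast, map_one, map_ofNat] at h2 ⊢
    linear_combination -(-1)^(k+1) * h2

lemma ibpI (P : ℝ[X]) (k a b : ℕ) : ((a:ℝ) + b + k + 2) * PI (P * R (k+1) a b * wt a b) =
    PI (derivative P * R k (a+1) (b+1) * wt (a+1) (b+1)) := by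
  have h := PI_deriv (P * (R k (a+1) (b+1) * wt (a+1) (b+1)))
  rw [derivative_mul, raise, PI_add] at h
  have e : P * -(C ((a:ℝ) + b + k + 2) * (R (k+1) a b * wt a b)) =
     C (-((a:ℝ) + b + k + 2)) * (P * R (k+1) a b * wt a b) := by
    rw [C_neg]; ring
  rw [e, PI_C] at h
  have z : (P * (R k (a+1) (b+1) * wt (a+1) (b+1))).eval 1 -
    (P * (R k (a+1) (b+1) * wt (a+1) (b+1))).eval 0 = 0 := by simp [wt]
  rw [z, ← mul_assoc (derivative P)] at h
  linarith

lemma ibpL (P : ℝ[X]) (k a b : ℕ) : ((a:ℝ) + b + k + 2) * PL (P * R (k+1) a b * wt a b) =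
    PL (derivative P * R k (a+1) (b+1) * wt (a+1) (b+1)) +
      PI (P * R k (a+1) (b+1) * (1 - X) * wt a b) := by
  have h := PL_deriv (P * R k (a+1) (b+1) * (1 - X) * wt a b)
  have e0 : X * (P * R k (a+1) (b+1) * (1 - X) * wt a b) =
    P * (R k (a+1) (b+1) * wt (a+1) (b+1)) := by rw [wt_succ]; ring
  rw [e0, derivative_mul, raise, PL_add] at h
  have e : P * -(C ((a:ℝ) + b + k + 2) * (R (k+1) a b * wt a b)) =
     C (-((a:ℝ) + b + k + 2)) * (P * R (k+1) a b * wt a b) := by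
    rw [C_neg]; ring
  rw [e, PL_C, ← mul_assoc (derivative P)] at h
  linarith

lemma orth (k : ℕ) : ∀ (a b : ℕ) (P : ℝ[X]), P.degree < k → PI (P * R k a b * wt a b) = 0 := by
  induction k with
  | zero =>
    intro a b P hP
    have : P = 0 := by
      rw [← degree_eq_bot]
      simpa using hP
    simp [this, PI]
  | succ k ih =>
    intro a b P hP
    have h : (a:ℝ) + b + k + 2 ≠ 0 := by positivity
    have h1 := ibpI P k a b
    rw [ih] at h1
    · simpa [h] using h1
    · by_cases h0 : P = 0
      · simp [h0]
      · by_cases hd : derivative P = 0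
        · simp [hd]
        · have := degree_derivative_lt h0
          rw [degree_eq_natDegree h0] at hP this
          rw [degree_eq_natDegree hd] at this ⊢
          norm_cast at *
          omega

/-- squared norm -/
noncomputable def hh (k a b : ℕ) : ℝ := PI (R k a b * R k a b * wt a b)
noncomputable def JJ (k a b : ℕ) : ℝ := PI (X * R k a b * R k a b * wt a b)
noncomputable def AA (k a b : ℕ) : ℝ := PL (R k a b * R k a b * wt a b)
noncomputable def BB (k a b : ℕ) : ℝ := PL (X * R k a b * R k a b * wt a b)

lemma hh_succ (k a b : ℕ) : ((a:ℝ) + b + k + 2) * hh (k+1) a b = (k+1) * hh k (a+1) (b+1) := by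
  have := ibpI (R (k+1) a b) k a b
  unfold hh
  rw [this, deriv_R, mul_assoc (C _), mul_assoc (C _), PI_C]

lemma AA_succ (k a b : ℕ) : ((a:ℝ) + b + k + 2) * AA (k+1) a b =
    (k+1) * AA k (a+1) (b+1) - hh (k+1) a b := by
  have := ibpL (R (k+1) a b) k a b
  unfold AA
  rw [this, deriv_R, mul_assoc (C _), mul_assoc (C _), PL_C]
  have o := orth (k+1) a b (R (k+1) a b - (X - C 1) * R k (a+1) (b+1)) (by
    have m1 : ((X - C 1) * R k (a+1) (b+1)).Monic := (monic_X_sub_C 1).mul (R_monic _ _ _)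
    have d1 : ((X - C 1) * R k (a+1) (b+1)).degree = ((k+1 : ℕ) : WithBot ℕ) := by
      rw [degree_mul, degree_X_sub_C, R_degree]; push_cast; ring
    have := degree_sub_lt_left (p := R (k+1) a b) (q := (X - C 1) * R k (a+1) (b+1)) (by rw [d1, R_degree])
      (R_monic _ _ _).ne_zero (by rw [m1, R_monic])
    rwa [R_degree] at this)
  have e : (R (k+1) a b - (X - C 1) * R k (a+1) (b+1)) * R (k+1) a b * wt a b =
    R (k+1) a b * R (k+1) a b * wt a b + R (k+1) a b * R k (a+1) (b+1) * (1 - X) * wt a b := by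
    simp; ring
  rw [e, PI_add] at o
  unfold hh
  linarith

/-- cross term -/
lemma cross_I (k a b : ℕ) : 2 * ((k:ℝ)+1) * PI (R (k+1) a b * R k (a+1) (b+1) * wt (a+1) (b+1)) =
    - (((a:ℝ)+1) * hh (k+1) a b - (a + b + 2) * JJ (k+1) a b) := by
  have h := PI_deriv (R (k+1) a b * R (k+1) a b * wt (a+1) (b+1))
  have e : derivative (R (k+1) a b * R (k+1) a b * wt (a+1) (b+1)) =
      C (2 * ((k:ℝ)+1)) * (R (k+1) a b * R k (a+1) (b+1) * wt (a+1) (b+1)) +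
      (C ((a:ℝ)+1) * (R (k+1) a b * R (k+1) a b * wt a b) + 
        C (-((a:ℝ)+b+2)) * (X * R (k+1) a b * R (k+1) a b * wt a b)) := by
    rw [derivative_mul, derivative_mul, deriv_R, deriv_wt, C_mul, C_neg]
    simp only [map_ofNat]
    ring
  rw [e, PI_add, PI_add, PI_C, PI_C, PI_C] at h
  have z : (R (k+1) a b * R (k+1) a b * wt (a+1) (b+1)).eval 1 -
    (R (k+1) a b * R (k+1) a b * wt (a+1) (b+1)).eval 0 = 0 := by simp [wt]
  rw [z] at h
  unfold hh JJ
  linarith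

lemma cross_L (k a b : ℕ) : 2 * ((k:ℝ)+1) * PL (R (k+1) a b * R k (a+1) (b+1) * wt (a+1) (b+1)) =
    - (hh (k+1) a b - JJ (k+1) a b) - (((a:ℝ)+1) * AA (k+1) a b - (a + b + 2) * BB (k+1) a b) := by
  have h := PL_deriv (R (k+1) a b * R (k+1) a b * wt a b + C (-1) * (X * R (k+1) a b * R (k+1) a b * wt a b))
  have e0 : X * (R (k+1) a b * R (k+1) a b * wt a b + C (-1) * (X * R (k+1) a b * R (k+1) a b * wt a b))
    = R (k+1) a b * R (k+1) a b * wt (a+1) (b+1) := by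
    rw [wt_succ]; simp; ring
  have e : derivative (R (k+1) a b * R (k+1) a b * wt (a+1) (b+1)) =
      C (2 * ((k:ℝ)+1)) * (R (k+1) a b * R k (a+1) (b+1) * wt (a+1) (b+1)) +
      (C ((a:ℝ)+1) * (R (k+1) a b * R (k+1) a b * wt a b) + 
        C (-((a:ℝ)+b+2)) * (X * R (k+1) a b * R (k+1) a b * wt a b)) := by
    rw [derivative_mul, derivative_mul, deriv_R, deriv_wt, C_mul, C_neg]
    simp only [map_ofNat]
    ring
  rw [e0, e, PL_add, PL_add, PL_C, PL_C, PL_C, PI_add, PI_C] at h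
  unfold hh JJ AA BB
  linarith

lemma JJ_succ (k a b : ℕ) : ((a:ℝ) + b + k + 2) * JJ (k+1) a b =
    PI (R (k+1) a b * R k (a+1) (b+1) * wt (a+1) (b+1)) + (k+1) * JJ k (a+1) (b+1) := by
  have := ibpI (X * R (k+1) a b) k a b
  unfold JJ
  rw [this, derivative_mul, deriv_R, derivative_X, ← PI_C, ← PI_add]
  congr 1
  simp only [map_add, map_natCast, map_one]
  ring

lemma BB_succ (k a b : ℕ) : ((a:ℝ) + b + k + 2) * BB (k+1) a b =
    PL (R (k+1) a b * R k (a+1) (b+1) * wt (a+1) (b+1)) + (k+1) * BB k (a+1) (b+1)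
    + PI (R (k+1) a b * R k (a+1) (b+1) * wt (a+1) (b+1)) := by
  have := ibpL (X * R (k+1) a b) k a b
  unfold BB
  rw [this, derivative_mul, deriv_R, derivative_X, ← PL_C, ← PL_add]
  congr 2
  · simp only [map_add, map_natCast, map_one]
    ring
  · rw [wt_succ]; ring

end JacEnt
namespace JacEnt
open Polynomial

/-- Harmonic numbers. -/
noncomputable def Hn (N : ℕ) : ℝ := ∑ j ∈ Finset.range N, 1 / (j + 1 : ℝ)

lemma Hn_succ (N : ℕ) : Hn (N+1) = Hn N + 1 / ((N:ℝ) + 1) := by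
  simp [Hn, Finset.sum_range_succ]

lemma PIw_left (a b : ℕ) : ((a:ℝ)+b+2) * PI (wt (a+1) b) = (a+1) * PI (wt a b) := by
  have h := PI_deriv (wt (a+1) (b+1))
  have e : derivative (wt (a+1) (b+1)) = C ((a:ℝ)+1) * wt a b + C (-((a:ℝ)+b+2)) * wt (a+1) b := by
    rw [deriv_wt, C_neg]; simp only [wt]; ring
  rw [e, PI_add, PI_C, PI_C] at h
  simp [wt] at h ⊢
  linarith

lemma wt_right (a b : ℕ) : wt a (b+1) = wt a b + C (-1) * wt (a+1) b := by
  simp [wt]; ring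

lemma PIw_right (a b : ℕ) : ((a:ℝ)+b+2) * PI (wt a (b+1)) = (b+1) * PI (wt a b) := by
  have := PIw_left a b
  rw [wt_right, PI_add, PI_C]
  linarith

lemma PIw_zero (a : ℕ) : ((a:ℝ)+1) * PI (wt a 0) = 1 := by
  have h := PI_deriv (X ^ (a+1))
  rw [derivative_X_pow] at h
  simp only [Nat.add_sub_cancel] at h
  rw [PI_C] at h
  simpa [wt] using h

lemma PIw_pos (a b : ℕ) : 0 < PI (wt a b) := by
  induction b with
  | zero =>
    have := PIw_zero a
    have h : (0:ℝ) < (a:ℝ)+1 := by positivity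
    exact pos_of_mul_pos_right (by rw [this]; exact one_pos) h.le
  | succ b ih =>
    have := PIw_right a b
    have h : (0:ℝ) < (a:ℝ)+b+2 := by positivity
    exact pos_of_mul_pos_right (by rw [this]; positivity) h.le

lemma PLw (b : ℕ) : ∀ a : ℕ, PL (wt a b) = -(Hn (a+b+1) - Hn a) * PI (wt a b) := by
  induction b with
  | zero =>
    intro a
    have h := PL_deriv (wt a 0)
    have e : derivative (X * wt a 0) = C ((a:ℝ)+1) * wt a 0 := by
      have : X * wt a 0 = X ^ (a+1) := by simp [wt]; ring
      rw [this, derivative_X_pow]; simp [wt]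
    rw [e, PL_C] at h
    rw [add_zero, Hn_succ]
    have h0 : (a:ℝ)+1 ≠ 0 := by positivity
    field_simp
    linarith
  | succ b ih =>
    intro a
    have h1 := PIw_left a b
    have h2 := PIw_right a b
    have h0 : (a:ℝ)+b+2 ≠ 0 := by positivity
    have h0' : (a:ℝ)+1 ≠ 0 := by positivity
    have h1' : PI (wt (a+1) b) = (a+1) * PI (wt a b) / ((a:ℝ)+b+2) := by
      field_simp; linarith
    have h2' : PI (wt a (b+1)) = (b+1) * PI (wt a b) / ((a:ℝ)+b+2) := by
      field_simp; linarith
    have e1 : Hn (a + (b+1) + 1) = Hn (a+b+1) + 1/((a:ℝ)+b+2) := by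
      rw [show a + (b+1) + 1 = (a+b+1)+1 by ring, Hn_succ]; push_cast; ring
    have e2 : Hn (a + 1 + b + 1) = Hn (a+b+1) + 1/((a:ℝ)+b+2) := by
      rw [show a + 1 + b + 1 = (a+b+1)+1 by ring, Hn_succ]; push_cast; ring
    rw [h2', wt_right, PL_add, PL_C, ih, ih, h1', e1, e2, Hn_succ a]
    field_simp
    ring

lemma hh_pos (k : ℕ) : ∀ a b : ℕ, 0 < hh k a b := by
  induction k with
  | zero => intro a b; simpa [hh, R] using PIw_pos a b
  | succ k ih =>
    intro a b
    have := hh_succ k a b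
    have h : (0:ℝ) < (a:ℝ)+b+k+2 := by positivity
    have h' := ih (a+1) (b+1)
    exact pos_of_mul_pos_right (by rw [this]; positivity) h.le

lemma AA_closed (k : ℕ) : ∀ a b : ℕ, AA k a b =
    hh k a b * (Hn (a+b+k) + Hn (a+k) - Hn (a+b+2*k) - Hn (a+b+2*k+1)) := by
  induction k with
  | zero =>
    intro a b
    have := PLw b a
    simp [AA, hh, R, this]; ring
  | succ k ih =>
    intro a b
    have h1 := AA_succ k a b
    have h2 := hh_succ k a b
    rw [ih] at h1
    have h0 : (a:ℝ)+b+k+2 ≠ 0 := by positivity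
    have h3 : ((k:ℝ)+1) ≠ 0 := by positivity
    have e : hh k (a+1) (b+1) = ((a:ℝ) + b + k + 2) * hh (k+1) a b / (k+1) := by
      field_simp; linarith
    rw [e] at h1
    have e1 : Hn (a+1+(b+1)+k) = Hn (a+b+(k+1)) + 1/((a:ℝ)+b+k+2) := by
      rw [show a+1+(b+1)+k = (a+b+(k+1))+1 by ring, Hn_succ]; push_cast; ring
    rw [e1, show a+1+(b+1)+2*k = a+b+2*(k+1) by ring, show a+1+k = a+(k+1) by ring] at h1
    apply mul_left_cancel₀ h0
    rw [h1]
    field_simp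
    ring

/-- recurrence coefficient -/
noncomputable def al (k a b : ℕ) : ℝ :=
  1/2 * (1 + ((a:ℝ)^2 - (b:ℝ)^2) / (((a:ℝ)+b+2*k) * ((a:ℝ)+b+2*k+2)))

noncomputable def ep (k a b : ℕ) : ℝ :=
  1/2 * (2*a*((a:ℝ)+b+2*k)*((a:ℝ)+b+2*k+2) - ((a:ℝ)^2-(b:ℝ)^2)*(2*((a:ℝ)+b+2*k)+2)) /
    (((a:ℝ)+b+2*k)^2 * ((a:ℝ)+b+2*k+2)^2) + 2 * (k * ((b:ℝ)+k)/((a:ℝ)+b+2*k)^2)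

lemma den_ne (k a b : ℝ) (hk : 0 ≤ k) (ha : 0 ≤ a) (hb : 0 ≤ b) :
    2 * (k+1) * (a+b+k+2) - (a+b+2) ≠ 0 := by
  have : 0 < 2 * (k+1) * (a+b+k+2) - (a+b+2) := by nlinarith [mul_nonneg hk ha, mul_nonneg hk hb, mul_nonneg hk hk]
  exact this.ne'

lemma JJ_zero (a b : ℕ) : JJ 0 a b = hh 0 a b * ((a+1)/((a:ℝ)+b+2)) := by
  have h := PIw_left a b
  have e : X * wt a b = wt (a+1) b := by simp only [wt]; ring
  have h0 : (a:ℝ)+b+2 ≠ 0 := by positivity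
  simp only [JJ, hh, R, mul_one, one_mul, e]
  field_simp
  linarith

lemma BB_zero (a b : ℕ) : BB 0 a b = 
    -(Hn (a+b+2) - Hn (a+1)) * (hh 0 a b * ((a+1)/((a:ℝ)+b+2))) := by
  rw [← JJ_zero]
  have e : X * wt a b = wt (a+1) b := by simp only [wt]; ring
  simp only [BB, JJ, R, mul_one, e]
  rw [PLw, show a+1+b+1 = a+b+2 by ring]

lemma JJ_closed (k : ℕ) : ∀ a b : ℕ, 0 < a + b + 2 * k → JJ k a b = hh k a b * al k a b := by
  induction k with
  | zero =>
    intro a b h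
    have h1 : (a:ℝ)+b ≠ 0 := by
      have : 0 < a + b := by simpa using h
      exact_mod_cast this.ne'
    have h0 : (a:ℝ)+b+2 ≠ 0 := by positivity
    rw [JJ_zero, al]
    push_cast
    rw [mul_zero, add_zero]
    field_simp
    ring
  | succ k ih =>
    intro a b _
    have h1 := JJ_succ k a b
    have h2 := hh_succ k a b
    have h3 := cross_I k a b
    rw [ih _ _ (by omega)] at h1
    have e : hh k (a+1) (b+1) = ((a:ℝ) + b + k + 2) * hh (k+1) a b / (k+1) := by
      field_simp; linarith
    have hN := den_ne k a b (by positivity) (by positivity) (by positivity)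
    rw [e] at h1
    apply mul_left_cancel₀ hN
    have h4 : (2 * ((k:ℝ)+1) * (a+b+k+2) - (a+b+2)) * JJ (k+1) a b = 
      2 * ((k:ℝ)+1) * (((k:ℝ)+1) * (((a:ℝ) + b + k + 2) * hh (k+1) a b / (k+1) * al k (a+1) (b+1)))
      - (a+1) * hh (k+1) a b := by linear_combination 2 * ((k:ℝ)+1) * h1 + h3
    rw [h4]
    have s1 : (a:ℝ)+b+2*(k+1) ≠ 0 := by positivity
    have s2 : (a:ℝ)+b+2*(k+1)+2 ≠ 0 := by positivity
    have s3 : (k:ℝ)+1 ≠ 0 := by positivity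
    simp only [al]
    push_cast
    rw [show (a:ℝ)+1+(b+1)+2*k = (a:ℝ)+b+2*(k+1) by ring]
    field_simp
    ring

lemma BB_closed (k : ℕ) : ∀ a b : ℕ, 0 < a + b + 2 * k → BB k a b = hh k a b *
    ((Hn (a+b+k) + Hn (a+k) - Hn (a+b+2*k) - Hn (a+b+2*k+1)) * al k a b + ep k a b) := by
  induction k with
  | zero =>
    intro a b h
    have h1 : (a:ℝ)+b ≠ 0 := by
      have : 0 < a + b := by simpa using h
      exact_mod_cast this.ne'
    have h0 : (a:ℝ)+b+2 ≠ 0 := by positivity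
    have h0' : (a:ℝ)+1 ≠ 0 := by positivity
    rw [BB_zero, al, ep, Hn_succ (a+b+1), Hn_succ a]
    push_cast
    simp only [mul_zero, add_zero, zero_mul, zero_div]
    rw [show (a:ℝ)+b+1+1 = a+b+2 by ring]
    field_simp
    ring
  | succ k ih =>
    intro a b hp
    have h1 := BB_succ k a b
    have h2 := hh_succ k a b
    have h3 := cross_I k a b
    have h5 := cross_L k a b
    rw [ih _ _ (by omega)] at h1
    rw [AA_closed] at h5
    rw [JJ_closed _ _ _ hp] at h3 h5
    have e : hh k (a+1) (b+1) = ((a:ℝ) + b + k + 2) * hh (k+1) a b / (k+1) := by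
      field_simp; linarith
    have e1 : Hn (a+1+(b+1)+k) = Hn (a+b+(k+1)) + 1/((a:ℝ)+b+k+2) := by
      rw [show a+1+(b+1)+k = (a+b+(k+1))+1 by ring, Hn_succ]; push_cast; ring
    rw [e1, show a+1+(b+1)+2*k = a+b+2*(k+1) by ring, show a+1+k = a+(k+1) by ring] at h1
    have hN := den_ne k a b (by positivity) (by positivity) (by positivity)
    rw [e] at h1
    apply mul_left_cancel₀ hN
    generalize Hn (a+b+(k+1)) = H1 at *
    generalize Hn (a+(k+1)) = H2 at *
    generalize Hn (a+b+2*(k+1)) = H3 at *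
    generalize Hn (a+b+2*(k+1)+1) = H4 at *
    set D := H1 + H2 - H3 - H4 with hD
    have hD' : H1 + 1/((a:ℝ)+b+k+2) + H2 - H3 - H4 = D + 1/((a:ℝ)+b+k+2) := by rw [hD]; ring
    rw [hD'] at h1
    generalize hh (k+1) a b = h at *
    have h4 : (2 * ((k:ℝ)+1) * (a+b+k+2) - (a+b+2)) * BB (k+1) a b = 
      2 * ((k:ℝ)+1) * (((k:ℝ)+1) * (((a:ℝ) + b + k + 2) * h / (k+1) * ((D + 1/((a:ℝ)+b+k+2)) * al k (a+1) (b+1) + ep k (a+1) (b+1))))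
      - ((a+1) * h - (a+b+2) * (h * al (k+1) a b)) - (h - h * al (k+1) a b) - (a+1) * (h * D) := by
        linear_combination 2 * ((k:ℝ)+1) * h1 + h3 + h5
    rw [h4]
    have s1 : (a:ℝ)+b+2*(k+1) ≠ 0 := by positivity
    have s2 : (a:ℝ)+b+2*(k+1)+2 ≠ 0 := by positivity
    have s3 : (k:ℝ)+1 ≠ 0 := by positivity
    have s4 : (a:ℝ)+b+k+2 ≠ 0 := by positivity
    clear_value D
    clear h1 h2 h3 h4 h5 hD hD' e e1 hN ih hp
    simp only [al, ep]
    push_cast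
    rw [show (a:ℝ)+1+(b+1)+2*k = (a:ℝ)+b+2*(k+1) by ring]
    field_simp
    ring

/-- The target entropy in terms of harmonic numbers. -/
noncomputable def FF (m a b : ℕ) : ℝ :=
  -((m:ℝ)*(m+b)/(2*m+a+b)) * Hn (m+b) + m/(2*m+a+b) + (2*m+a+b) * Hn (a+b+2*m)
   - m*(m+a)/(2*m+a+b) * Hn (a+m) - (m+a+b) * Hn (a+b+m) - m

lemma FF_zero (a b : ℕ) : FF 0 a b = 0 := by simp [FF]

lemma FF_succ (k a b : ℕ) : FF (k+1) a b - FF k a b = - (BB k a b / hh k a b + BB k b a / hh k b a) := by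
  have p1 := (hh_pos k a b).ne'
  have p2 := (hh_pos k b a).ne'
  by_cases h : 0 < a + b + 2 * k
  · rw [BB_closed k a b h, BB_closed k b a (by omega), mul_div_cancel_left₀ _ p1, mul_div_cancel_left₀ _ p2]
    have q1 : (a:ℝ) + b + 2 * k ≠ 0 := by exact_mod_cast h.ne'
    have q1' : (a:ℝ) + b + k * 2 ≠ 0 := by rwa [mul_comm (k:ℝ)]
    have q2 : (a:ℝ) + b + 2 * k + 2 ≠ 0 := by positivity
    have q3 : (a:ℝ) + b + k + 1 ≠ 0 := by positivity
    have q4 : (a:ℝ) + k + 1 ≠ 0 := by positivity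
    have q5 : (b:ℝ) + k + 1 ≠ 0 := by positivity
    have q6 : (a:ℝ) + b + 2 * k + 1 ≠ 0 := by positivity
    simp only [FF, al, ep]
    rw [show k + 1 + b = (b+k)+1 by ring, show a+b+2*(k+1) = (a+b+2*k+1)+1 by ring,
      show a+(k+1) = (a+k)+1 by ring, show a+b+(k+1) = (a+b+k)+1 by ring, show b+a = a+b by ring,
      show k + b = b + k by ring]
    simp only [Hn_succ]
    push_cast
    rw [show (2*((k:ℝ)+1)+a+b) = a+b+2*k+2 by ring, show (2*(k:ℝ)+a+b) = a+b+2*k by ring,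
      show (b:ℝ)+a+2*k = a+b+2*k by ring, show (a:ℝ)+b+2*k+1+1 = a+b+2*k+2 by ring]
    generalize Hn (a+b+k) = H1
    generalize Hn (a+k) = H2
    generalize Hn (b+k) = H3
    generalize Hn (a+b+2*k) = H4
    field_simp
    ring
  · have h1 : a = 0 := by omega
    have h2 : b = 0 := by omega
    have h3 : k = 0 := by omega
    subst h1 h2 h3
    rw [BB_zero]
    field_simp
    simp [FF, Hn, Finset.sum_range_succ]
    norm_num

lemma FF_sum (m a b : ℕ) : ∑ k ∈ Finset.range m, (BB k a b / hh k a b + BB k b a / hh k b a) = - FF m a b := by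
  induction m with
  | zero => simp [FF_zero]
  | succ m ih => rw [Finset.sum_range_succ, ih]; linarith [FF_succ m a b]

end JacEnt
namespace JacEnt
open Polynomial

lemma det_int {m : ℕ} (φ U : Fin m → ℝ → ℝ)
    (hint : ∀ i j k, Integrable (fun x => φ j x * φ k x * U i x))
    (horth : ∀ σ τ : Equiv.Perm (Fin m), σ ≠ τ → ∃ i, ∫ x, φ (σ i) x * φ (τ i) x * U i x = 0) :
    Integrable (fun x : Fin m → ℝ => (Matrix.of fun k i => φ k (x i)).det ^ 2 * ∏ i, U i (x i)) ∧
    ∫ x : Fin m → ℝ, (Matrix.of fun k i => φ k (x i)).det ^ 2 * ∏ i, U i (x i) =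
      ∑ σ : Equiv.Perm (Fin m), ∏ i, ∫ x, φ (σ i) x * φ (σ i) x * U i x := by
  have e : (fun x : Fin m → ℝ => (Matrix.of fun k i => φ k (x i)).det ^ 2 * ∏ i, U i (x i)) =
      fun x => ∑ σ : Equiv.Perm (Fin m), ∑ τ : Equiv.Perm (Fin m),
        (((Equiv.Perm.sign σ : ℤ) : ℝ) * ((Equiv.Perm.sign τ : ℤ) : ℝ)) *
          ∏ i, (φ (σ i) (x i) * φ (τ i) (x i) * U i (x i)) := by
    ext x
    rw [Matrix.det_apply', sq, Finset.sum_mul_sum, Finset.sum_mul]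
    refine Finset.sum_congr rfl fun σ _ => ?_
    rw [Finset.sum_mul]
    refine Finset.sum_congr rfl fun τ _ => ?_
    simp only [Matrix.of_apply, Finset.prod_mul_distrib]
    ring
  have hI : ∀ σ τ : Equiv.Perm (Fin m), Integrable (fun x : Fin m → ℝ =>
      (((Equiv.Perm.sign σ : ℤ) : ℝ) * ((Equiv.Perm.sign τ : ℤ) : ℝ)) *
          ∏ i, (φ (σ i) (x i) * φ (τ i) (x i) * U i (x i))) := by
    intro σ τ
    apply Integrable.const_mul
    exact Integrable.fintype_prod (f := fun i x => φ (σ i) x * φ (τ i) x * U i x)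
      (fun i => hint i _ _)
  rw [e]
  refine ⟨integrable_finsetSum _ fun σ _ => integrable_finsetSum _ fun τ _ => hI σ τ, ?_⟩
  rw [integral_finsetSum _ fun σ _ => integrable_finsetSum _ fun τ _ => hI σ τ]
  refine Finset.sum_congr rfl fun σ _ => ?_
  rw [integral_finsetSum _ fun τ _ => hI σ τ]
  have hval : ∀ τ : Equiv.Perm (Fin m), ∫ x : Fin m → ℝ,
      (((Equiv.Perm.sign σ : ℤ) : ℝ) * ((Equiv.Perm.sign τ : ℤ) : ℝ)) *
          ∏ i, (φ (σ i) (x i) * φ (τ i) (x i) * U i (x i)) =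
      (((Equiv.Perm.sign σ : ℤ) : ℝ) * ((Equiv.Perm.sign τ : ℤ) : ℝ)) *
          ∏ i, ∫ x, φ (σ i) x * φ (τ i) x * U i x := by
    intro τ
    rw [integral_const_mul]
    congr 1
    exact integral_fintype_prod_volume_eq_prod (f := fun i x => φ (σ i) x * φ (τ i) x * U i x)
  rw [Finset.sum_eq_single σ]
  · rw [hval]
    have : (((Equiv.Perm.sign σ : ℤ) : ℝ) * ((Equiv.Perm.sign σ : ℤ) : ℝ)) = 1 := by
      rcases Int.units_eq_one_or (Equiv.Perm.sign σ) with h | h <;> simp [h]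
    rw [this, one_mul]
  · intro τ _ hτ
    rw [hval]
    obtain ⟨i, hi⟩ := horth σ τ hτ.symm
    rw [Finset.prod_eq_zero (Finset.mem_univ i) hi, mul_zero]
  · simp

lemma perm_ne {m : ℕ} (l : Fin m) (σ τ : Equiv.Perm (Fin m)) (h : σ ≠ τ) :
    ∃ i, i ≠ l ∧ σ i ≠ τ i := by
  by_contra hc
  push Not at hc
  apply h
  ext1 i
  by_cases hi : i = l
  · subst hi
    by_contra hne
    have : σ (σ.symm (τ i)) = τ i := by simp
    by_cases h2 : σ.symm (τ i) = i
    · rw [h2] at this; exact hne this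
    · have h3 := hc _ h2
      rw [this] at h3
      exact h2 (τ.injective h3).symm
  · exact hc i hi

lemma ensemble {m : ℕ} (φ : Fin m → ℝ → ℝ) (W g : ℝ → ℝ)
    (hW : ∀ j k, Integrable (fun x => φ j x * φ k x * W x))
    (hg : ∀ j k, Integrable (fun x => φ j x * φ k x * (g x * W x)))
    (ho : ∀ j k, j ≠ k → ∫ x, φ j x * φ k x * W x = 0)
    (hn : ∀ k, ∫ x, φ k x * φ k x * W x ≠ 0) :
    (∫ x : Fin m → ℝ, (Matrix.of fun k i => φ k (x i)).det ^ 2 * ∏ i, W (x i)) ≠ 0 ∧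
    ∫ x : Fin m → ℝ, (∑ l, g (x l)) * ((Matrix.of fun k i => φ k (x i)).det ^ 2 * ∏ i, W (x i)) =
      (∑ k, (∫ x, φ k x * φ k x * (g x * W x)) / (∫ x, φ k x * φ k x * W x)) *
      ∫ x : Fin m → ℝ, (Matrix.of fun k i => φ k (x i)).det ^ 2 * ∏ i, W (x i) := by
  have h1 := (det_int φ (fun _ => W) (fun _ => hW) (fun σ τ h => by
    have : ∃ i, σ i ≠ τ i := by
      by_contra hc; push Not at hc; exact h (Equiv.ext hc)
    obtain ⟨i, hi⟩ := this
    exact ⟨i, ho _ _ hi⟩)).2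
  set h : Fin m → ℝ := fun k => ∫ x, φ k x * φ k x * W x with hh
  set G : Fin m → ℝ := fun k => ∫ x, φ k x * φ k x * (g x * W x) with hG
  have hp : ∀ σ : Equiv.Perm (Fin m), ∏ i, h (σ i) = ∏ i, h i := fun σ => Equiv.prod_comp σ h
  have hN : ∫ x : Fin m → ℝ, (Matrix.of fun k i => φ k (x i)).det ^ 2 * ∏ i, W (x i) =
     ∑ σ : Equiv.Perm (Fin m), ∏ i, h i := by
    rw [h1]; exact Finset.sum_congr rfl fun σ _ => hp σ
  have hU : ∀ l : Fin m, 
     Integrable (fun x : Fin m → ℝ => g (x l) * ((Matrix.of fun k i => φ k (x i)).det ^ 2 * ∏ i, W (x i))) ∧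
     ∫ x : Fin m → ℝ, g (x l) * ((Matrix.of fun k i => φ k (x i)).det ^ 2 * ∏ i, W (x i)) =
     ∑ σ : Equiv.Perm (Fin m), (G (σ l) / h (σ l)) * ∏ i, h i := by
    intro l
    have h2 := det_int φ (fun i x => if i = l then g x * W x else W x) (fun i j k => by
      by_cases hi : i = l
      · simpa [hi] using hg j k
      · simpa [hi] using hW j k) (fun σ τ hne => by
        obtain ⟨i, hi, hi2⟩ := perm_ne l σ τ hne
        exact ⟨i, by simpa [hi] using ho _ _ hi2⟩)
    have e : ∀ x : Fin m → ℝ, g (x l) * ((Matrix.of fun k i => φ k (x i)).det ^ 2 * ∏ i, W (x i)) =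
      (Matrix.of fun k i => φ k (x i)).det ^ 2 * ∏ i, (if i = l then g (x i) * W (x i) else W (x i)) := by
      intro x
      rw [← Finset.mul_prod_erase _ _ (Finset.mem_univ l),
        ← Finset.mul_prod_erase Finset.univ (fun i => if i = l then g (x i) * W (x i) else W (x i)) (Finset.mem_univ l)]
      rw [if_pos rfl, Finset.prod_congr (g := fun i => W (x i)) rfl (fun i hi => if_neg (Finset.ne_of_mem_erase hi))]
      ring
    simp only [e]
    refine ⟨h2.1, ?_⟩
    rw [h2.2]
    refine Finset.sum_congr rfl fun σ _ => ?_
    rw [← hp σ, ← Finset.mul_prod_erase _ _ (Finset.mem_univ l),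
      ← Finset.mul_prod_erase Finset.univ (fun i => h (σ i)) (Finset.mem_univ l)]
    rw [Finset.prod_congr (g := fun i => h (σ i)) rfl (fun i hi => by
      simp [Finset.ne_of_mem_erase hi, hh])]
    have hnl : h (σ l) ≠ 0 := hn _
    simp only [if_true]
    change G (σ l) * _ = _
    field_simp
  constructor
  · rw [hN, Finset.sum_const]
    rw [nsmul_eq_mul]
    refine mul_ne_zero ?_ (Finset.prod_ne_zero_iff.mpr fun i _ => hn i)
    simp [Fintype.card_perm, Nat.factorial_ne_zero]
  · have L : ∫ x : Fin m → ℝ, (∑ l, g (x l)) * ((Matrix.of fun k i => φ k (x i)).det ^ 2 * ∏ i, W (x i)) =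
        ∑ l, ∑ σ : Equiv.Perm (Fin m), (G (σ l) / h (σ l)) * ∏ i, h i := by
      simp only [Finset.sum_mul]
      rw [integral_finsetSum _ fun l _ => (hU l).1]
      exact Finset.sum_congr rfl fun l _ => (hU l).2
    rw [L, hN, Finset.sum_comm, Finset.mul_sum]
    refine Finset.sum_congr rfl fun σ _ => ?_
    rw [← Finset.sum_mul, Equiv.sum_comp σ (fun k => G k / h k)]

/-- transferred weight -/
noncomputable def Wx (a b : ℕ) : ℝ → ℝ :=
  Set.indicator (Set.Icc (-1) 1) (fun x => (wt a b).eval ((1 + x) / 2))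

lemma int_transfer (F : ℝ → ℝ) :
    ∫ x, Set.indicator (Set.Icc (-1) 1) (fun x => F ((1 + x) / 2)) x = 2 * ∫ t in (0:ℝ)..1, F t := by
  rw [integral_indicator measurableSet_Icc, integral_Icc_eq_integral_Ioc,
    ← intervalIntegral.integral_of_le (by norm_num)]
  have h := intervalIntegral.integral_comp_mul_add (a := (-1:ℝ)) (b := 1) F (c := 1/2) (by norm_num) (1/2)
  have e : ∀ x : ℝ, (1 + x) / 2 = 1 / 2 * x + 1 / 2 := fun x => by ring
  simp only [e]
  rw [h, smul_eq_mul]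
  norm_num

lemma integrable_transfer (F : ℝ → ℝ) (hF : Continuous F) :
    Integrable (Set.indicator (Set.Icc (-1) 1) (fun x : ℝ => F ((1 + x) / 2))) := by
  rw [integrable_indicator_iff measurableSet_Icc]
  apply ContinuousOn.integrableOn_Icc
  exact (hF.comp (by fun_prop)).continuousOn

/-- entropy integrand in the variable t -/
noncomputable def vt (t : ℝ) : ℝ := t * Real.log t + (1 - t) * Real.log (1 - t)

lemma vt_cont : Continuous vt := by
  unfold vt
  exact Real.continuous_mul_log.add (Real.continuous_mul_log.comp (by fun_prop : Continuous fun t : ℝ => 1 - t))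

lemma vEnt_eq (x : ℝ) : vEnt x = vt ((1 + x) / 2) := by
  unfold vEnt vt
  rw [show 1 - (1 + x) / 2 = (1 - x)/2 by ring]; ring

lemma int_one_sub (F : ℝ → ℝ) : ∫ t in (0:ℝ)..1, F (1 - t) = ∫ t in (0:ℝ)..1, F t := by
  simp

lemma RRw_symm (k a b : ℕ) (t : ℝ) :
    (R k a b * R k a b * wt a b).eval (1 - t) = (R k b a * R k b a * wt b a).eval t := by
  have h := congrArg (fun P => P.eval t) (R_symm k a b)
  simp only [eval_comp, eval_sub, eval_one, eval_X, eval_mul, eval_pow, eval_neg] at h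
  simp only [eval_mul, h, wt, eval_pow, eval_sub, eval_one, eval_X]
  have : ((-1:ℝ)^k)*((-1)^k) = 1 := by rw [← mul_pow]; simp
  linear_combination (eval t (R k b a) * eval t (R k b a) * (1-t)^a * t^b) * this

lemma hh_symm (k a b : ℕ) : hh k a b = hh k b a := by
  unfold hh PI
  rw [← int_one_sub]
  simp only [RRw_symm]

lemma int_v (k a b : ℕ) : ∫ t in (0:ℝ)..1, vt t * (R k a b * R k a b * wt a b).eval t =
    BB k a b + BB k b a := by
  have h1 : BB k a b = ∫ t in (0:ℝ)..1, (t * Real.log t) * (R k a b * R k a b * wt a b).eval t := by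
    unfold BB PL
    congr 1; ext t; simp; ring
  have h2 : BB k b a = ∫ t in (0:ℝ)..1, ((1 - t) * Real.log (1 - t)) * (R k a b * R k a b * wt a b).eval t := by
    rw [← int_one_sub (fun t => ((1 - t) * Real.log (1 - t)) * (R k a b * R k a b * wt a b).eval t)]
    simp only [RRw_symm, sub_sub_cancel]
    unfold BB PL
    congr 1; ext t; simp; ring
  rw [h1, h2, ← intervalIntegral.integral_add]
  · congr 1; ext t; simp only [vt]; ring
  · apply Continuous.intervalIntegrable
    exact Real.continuous_mul_log.mul (Polynomial.continuous _)
  · apply Continuous.intervalIntegrable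
    exact (Real.continuous_mul_log.comp (by fun_prop : Continuous fun t : ℝ => 1 - t)).mul (Polynomial.continuous _)

lemma orth' (j k a b : ℕ) (h : j ≠ k) : PI (R j a b * R k a b * wt a b) = 0 := by
  rcases lt_or_gt_of_ne h with h | h
  · exact orth k a b _ (by rw [R_degree]; exact_mod_cast h)
  · rw [mul_comm (R j a b)]
    exact orth j a b _ (by rw [R_degree]; exact_mod_cast h)

lemma phiW (P Q : ℝ[X]) (a b : ℕ) : (fun x => P.eval ((1+x)/2) * Q.eval ((1+x)/2) * Wx a b x) =
    Set.indicator (Set.Icc (-1) 1) (fun x => (fun t => (P * Q * wt a b).eval t) ((1 + x) / 2)) := by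
  ext x
  by_cases hx : x ∈ Set.Icc (-1:ℝ) 1 <;> simp [Wx, hx, -Set.mem_Icc]

lemma phigW (P Q : ℝ[X]) (a b : ℕ) :
    (fun x => P.eval ((1+x)/2) * Q.eval ((1+x)/2) * (vEnt x * Wx a b x)) =
    Set.indicator (Set.Icc (-1) 1) (fun x => (fun t => vt t * (P * Q * wt a b).eval t) ((1 + x) / 2)) := by
  ext x
  by_cases hx : x ∈ Set.Icc (-1:ℝ) 1
  · simp [Wx, hx, -Set.mem_Icc, vEnt_eq]; ring
  · simp [Wx, hx, -Set.mem_Icc]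

lemma int_phiW (P Q : ℝ[X]) (a b : ℕ) :
    ∫ x, P.eval ((1+x)/2) * Q.eval ((1+x)/2) * Wx a b x = 2 * PI (P * Q * wt a b) := by
  rw [phiW]
  exact int_transfer (fun t => (P * Q * wt a b).eval t)

lemma int_phigW (P Q : ℝ[X]) (a b : ℕ) :
    ∫ x, P.eval ((1+x)/2) * Q.eval ((1+x)/2) * (vEnt x * Wx a b x) =
      2 * ∫ t in (0:ℝ)..1, vt t * (P * Q * wt a b).eval t := by
  rw [phigW]
  exact int_transfer (fun t => vt t * (P * Q * wt a b).eval t)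

lemma density_eq (m a b : ℕ) : ∃ K : ℝ, K ≠ 0 ∧ ∀ x : Fin m → ℝ,
    densityB m (b + (a + m)) (a + m) x = K *
      ((Matrix.of fun k i => (fun (k : Fin m) (x : ℝ) => (R k a b).eval ((1+x)/2)) k (x i)).det ^ 2
        * ∏ i, Wx a b (x i)) := by
  refine ⟨(∏ q ∈ Finset.univ.filter (fun q : Fin m × Fin m => q.1 < q.2), (4:ℝ)) * ∏ i : Fin m, (2:ℝ)^(a+b), 
    mul_ne_zero (Finset.prod_ne_zero_iff.mpr fun _ _ => by norm_num)
     (Finset.prod_ne_zero_iff.mpr fun _ _ => by positivity), fun x => ?_⟩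
  have hV := Matrix.det_eval_matrixOfPolynomials_eq_det_vandermonde (fun i => (1 + x i)/2)
    (fun k : Fin m => R k a b) (fun k => R_natDegree k a b) (fun k => R_monic k a b)
  have hD : (Matrix.of fun k i => (fun (k : Fin m) (x : ℝ) => (R k a b).eval ((1+x)/2)) k (x i)).det =
      (Matrix.vandermonde (fun i => (1 + x i)/2)).det := by
    rw [hV, ← Matrix.det_transpose]; rfl
  rw [hD, Matrix.det_vandermonde]
  unfold densityB
  by_cases hx : ∀ i, x i ∈ Set.Icc (-1:ℝ) 1
  · rw [if_pos hx]
    have e1 : ∏ i, Wx a b (x i) = ∏ i, (wt a b).eval ((1 + x i)/2) :=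
      Finset.prod_congr rfl fun i _ => by simp [Wx, Set.indicator_of_mem (hx i)]
    have e2 : (∏ q ∈ Finset.univ.filter (fun q : Fin m × Fin m => q.1 < q.2), (x q.1 - x q.2)^2) =
      (∏ q ∈ Finset.univ.filter (fun q : Fin m × Fin m => q.1 < q.2), (4:ℝ)) *
      (∏ i : Fin m, ∏ j ∈ Finset.Ioi i, ((1 + x j)/2 - (1 + x i)/2))^2 := by
      have : (∏ i : Fin m, ∏ j ∈ Finset.Ioi i, ((1 + x j)/2 - (1 + x i)/2)) =
        ∏ q ∈ Finset.univ.filter (fun q : Fin m × Fin m => q.1 < q.2), ((1 + x q.2)/2 - (1 + x q.1)/2) := by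
        rw [Finset.prod_filter, Fintype.prod_prod_type]
        refine Finset.prod_congr rfl fun i _ => ?_
        rw [← Finset.prod_filter]
        refine Finset.prod_congr ?_ fun _ _ => rfl
        ext j; simp
      rw [this, ← Finset.prod_pow, ← Finset.prod_mul_distrib]
      exact Finset.prod_congr rfl fun q _ => by ring
    have e3 : ∏ i, (1 + x i) ^ (a + m - m) * (1 - x i) ^ (b + (a + m) - (a + m)) =
        (∏ i : Fin m, (2:ℝ)^(a+b)) * ∏ i, (wt a b).eval ((1 + x i)/2) := by
      rw [← Finset.prod_mul_distrib]
      refine Finset.prod_congr rfl fun i _ => ?_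
      simp only [Nat.add_sub_cancel, wt, eval_mul, eval_pow, eval_sub, eval_X, eval_one]
      rw [show 1 - (1 + x i)/2 = (1 - x i)/2 by ring, div_pow, div_pow, pow_add]
      field_simp
    rw [e1, e2, e3]; ring
  · rw [if_neg hx]
    push Not at hx
    obtain ⟨i, hi⟩ := hx
    have hz : ∏ i, Wx a b (x i) = 0 :=
      Finset.prod_eq_zero (Finset.mem_univ i) (Set.indicator_of_notMem hi _)
    rw [hz, mul_zero, mul_zero]

lemma mean_eq (m a b : ℕ) : ensembleAvg (densityB m (b + (a + m)) (a + m)) entS = FF m a b := by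
  obtain ⟨K, hK, hd⟩ := density_eq m a b
  have hE := ensemble (fun (k : Fin m) (x : ℝ) => (R k a b).eval ((1+x)/2)) (Wx a b) vEnt
    (fun j k => by
      rw [phiW]; exact integrable_transfer _ (Polynomial.continuous _))
    (fun j k => by
      rw [phigW]; exact integrable_transfer _ (vt_cont.mul (Polynomial.continuous _)))
    (fun j k hjk => by
      rw [int_phiW, orth' j k a b (fun h => hjk (Fin.ext h)), mul_zero])
    (fun k => by
      rw [int_phiW]
      have := hh_pos k a b
      unfold hh at this
      positivity)
  have hsum : (∑ k : Fin m, (∫ x, (R k a b).eval ((1+x)/2) * (R k a b).eval ((1+x)/2) * (vEnt x * Wx a b x)) /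
      (∫ x, (R k a b).eval ((1+x)/2) * (R k a b).eval ((1+x)/2) * Wx a b x)) = - FF m a b := by
    rw [← FF_sum, ← Fin.sum_univ_eq_sum_range (fun k => BB k a b / hh k a b + BB k b a / hh k b a)]
    refine Finset.sum_congr rfl fun k _ => ?_
    rw [int_phiW, int_phigW, int_v, hh_symm k b a, ← add_div]
    rw [mul_div_mul_left _ _ two_ne_zero]
    rfl
  obtain ⟨hN, hS⟩ := hE
  rw [hsum] at hS
  unfold ensembleAvg
  simp only [hd]
  rw [integral_const_mul]
  have e : ∀ x : Fin m → ℝ, entS x * (K * ((Matrix.of fun k i => (fun (k : Fin m) (x : ℝ) => (R k a b).eval ((1+x)/2)) k (x i)).det ^ 2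
        * ∏ i, Wx a b (x i))) = (-K) * ((∑ l, vEnt (x l)) * ((Matrix.of fun k i => (fun (k : Fin m) (x : ℝ) => (R k a b).eval ((1+x)/2)) k (x i)).det ^ 2
        * ∏ i, Wx a b (x i))) := by
    intro x; simp only [entS]; ring
  simp only [e]
  rw [integral_const_mul, hS]
  field_simp

end JacEnt

theorem mean_vonNeumann_entropy_caseB (m n p : ℕ) (hm : 1 ≤ m) (hmp : m ≤ p) (hpn : p ≤ n) :
    ensembleAvg (densityB m n p) entS =
      -((m : ℝ) * (m + n - p) / (m + n)) * psi0 (m + n - p) + (m + n) * psi0 (m + n + 1)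
        - (m * p / (m + n)) * psi0 (p + 1) - n * psi0 (n + 1) - m := by
  obtain ⟨a, rfl⟩ : ∃ a, p = a + m := ⟨p - m, by omega⟩
  obtain ⟨b, rfl⟩ : ∃ b, n = b + (a + m) := ⟨n - (a + m), by omega⟩
  rw [JacEnt.mean_eq]
  have hp : ∀ N, psi0 (N + 1) = -Real.eulerMascheroniConstant + JacEnt.Hn N := fun N => by
    simp [psi0, JacEnt.Hn]
  obtain ⟨r, rfl⟩ : ∃ r, m = r + 1 := ⟨m - 1, by omega⟩
  rw [show r + 1 + (b + (a + (r + 1))) - (a + (r + 1)) = (r + b) + 1 by omega]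
  simp only [hp]
  unfold JacEnt.FF
  rw [show r + 1 + b = (r + b) + 1 by ring, JacEnt.Hn_succ (r+b),
    show r + 1 + (b + (a + (r + 1))) = a + b + 2 * (r+1) by ring,
    show b + (a + (r + 1)) = a + b + (r + 1) by ring]
  have h1 : (r:ℝ) + b + 1 ≠ 0 := by positivity
  have h2 : 2 * ((r:ℝ) + 1) + a + b ≠ 0 := by positivity
  push_cast
  rw [show (r:ℝ) + 1 + (a + b + (r + 1)) = 2 * ((r:ℝ) + 1) + a + b by ring]
  field_simp
  ring
end
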